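/- arXiv:1710.09795 — 9 statements merged into one kernel-verified Lean document; each statement's English description precedes it below -/
import Mathlib

section
/- Let 0 < ε ≤ 1 and let S be a string over some alphabet. Suppose there are indices i₁ < j₁ ≤ i₂ < j₂ (all within the index range of S) such that, writing l = (j₁ - i₁) + (j₂ - i₂), we have ED(S[i₁,j₁), S[i₂,j₂)) ≤ (1-ε)·l. Then there exist indices i₁', j₁', i₂', j₂' with i₁ ≤ i₁' < j₁' ≤ j₁ and i₂ ≤ i₂' < j₂' ≤ j₂ such that the total length l' = (j₁' - i₁') + (j₂' - i₂') satisfies l' ∈ {⌈l/2⌉ - 1, ⌈l/2⌉, ⌈l/2⌉ + 1} and ED(S[i₁',j₁'), S[i₂',j₂')) ≤ (1-ε)·l'. -/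
/-- Length of a longest common subsequence of `a` and `b`. -/
def lcsLen {α : Type*} [DecidableEq α] (a b : List α) : ℕ :=
  ((a.sublists.filter (fun c => decide (c.Sublist b))).map List.length).foldr max 0

/-- Edit distance: the minimum number of single-symbol insertions and deletions
transforming one string into the other, via `ED a b = |a| + |b| - 2·LCS(a,b)`. -/
def ED {α : Type*} [DecidableEq α] (a b : List α) : ℕ :=
  a.length + b.length - 2 * lcsLen a b

/-- `substr S i j` is the substring `S[i,j)` from 1-based position `i` (inclusive)
to position `j` (exclusive). -/
def substr {α : Type*} (S : List α) (i j : ℕ) : List α :=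
  (S.drop (i - 1)).take (j - i)


theorem length_le_lcsLen {α : Type*} [DecidableEq α] {a b c : List α}
    (ha : c.Sublist a) (hb : c.Sublist b) : c.length ≤ lcsLen a b := by
  have aux : ∀ (L : List ℕ) (n : ℕ), n ∈ L → n ≤ L.foldr max 0 := by
    intro L
    induction L with
    | nil => simp
    | cons x L ih =>
      intro n hn
      rcases List.mem_cons.1 hn with rfl | h
      · exact le_max_left _ _
      · exact (ih n h).trans (le_max_right _ _)
  refine aux _ _ (List.mem_map.2 ⟨c, ?_, rfl⟩)
  simp [ha, hb]

theorem exists_sublist_length_eq_lcsLen {α : Type*} [DecidableEq α] (a b : List α) :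
    ∃ c : List α, c.Sublist a ∧ c.Sublist b ∧ c.length = lcsLen a b := by
  have aux : ∀ L : List ℕ, L.foldr max 0 = 0 ∨ L.foldr max 0 ∈ L := by
    intro L
    induction L with
    | nil => simp
    | cons x L ih =>
      simp only [List.foldr_cons, List.mem_cons]
      rcases max_cases x (L.foldr max 0) with h | h <;> grind
  rcases aux ((a.sublists.filter (·.Sublist b)).map List.length) with h | h
  · exact ⟨[], by simp, by simp, h.symm⟩
  · obtain ⟨c, hc, hl⟩ := List.mem_map.1 h
    simp only [List.mem_filter, List.mem_sublists, decide_eq_true_eq] at hc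
    exact ⟨c, hc.1, hc.2, hl⟩

/-- An alignment of `a` and `b` along a common subsequence `c` can be cut so that the prefixes
have any prescribed total length, up to an excess of one. -/
theorem exists_split_common_sublist {α : Type*} (a b c : List α) (t : ℕ)
    (ha : c.Sublist a) (hb : c.Sublist b) (ht : t ≤ a.length + b.length) :
    ∃ a₁ a₂ b₁ b₂ c₁ c₂ : List α, a = a₁ ++ a₂ ∧ b = b₁ ++ b₂ ∧ c = c₁ ++ c₂ ∧
      c₁.Sublist a₁ ∧ c₂.Sublist a₂ ∧ c₁.Sublist b₁ ∧ c₂.Sublist b₂ ∧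
      t ≤ a₁.length + b₁.length ∧ a₁.length + b₁.length ≤ t + 1 := by
  induction a generalizing b c t with
  | nil =>
    obtain rfl := List.sublist_nil.1 ha
    simp only [List.length_nil, zero_add] at ht
    exact ⟨[], [], b.take t, b.drop t, [], [], by simp, by simp, by simp, by simp, by simp,
      by simp, by simp, by simp [ht], by simp⟩
  | cons x a iha =>
    induction b generalizing c t with
    | nil =>
      obtain rfl := List.sublist_nil.1 hb
      simp only [List.length_nil, add_zero] at ht
      exact ⟨(x :: a).take t, (x :: a).drop t, [], [], [], [], by simp, by simp, by simp,
        by simp, by simp, by simp, by simp, by simpa using ht, by simp⟩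
    | cons y b ihb =>
      rcases Nat.eq_zero_or_pos t with rfl | hpos
      · exact ⟨[], x :: a, [], y :: b, [], c, rfl, rfl, rfl, by simp, ha, by simp, hb,
          by simp, by simp⟩
      simp only [List.length_cons] at ht
      rcases List.sublist_cons_iff.1 ha with ha' | ⟨c', rfl, ha'⟩
      · obtain ⟨a₁, a₂, b₁, b₂, c₁, c₂, h1, h2, h3, h4, h5, h6, h7, h8, h9⟩ :=
          iha (y :: b) c (t - 1) ha' hb (by simp only [List.length_cons]; omega)
        exact ⟨x :: a₁, a₂, b₁, b₂, c₁, c₂, by simp [h1], h2, h3, h4.cons _, h5, h6, h7,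
          by simp only [List.length_cons]; omega, by simp only [List.length_cons]; omega⟩
      rcases List.sublist_cons_iff.1 hb with hb' | ⟨c'', hc, hb'⟩
      · obtain ⟨a₁, a₂, b₁, b₂, c₁, c₂, h1, h2, h3, h4, h5, h6, h7, h8, h9⟩ :=
          ihb (x :: c') (t - 1) ha hb' (by simp only [List.length_cons]; omega)
        exact ⟨a₁, a₂, y :: b₁, b₂, c₁, c₂, h1, by simp [h2], h3, h4, h5, h6.cons _, h7,
          by simp only [List.length_cons]; omega, by simp only [List.length_cons]; omega⟩
      obtain ⟨rfl, rfl⟩ := List.cons_eq_cons.1 hc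
      rcases (show t = 1 ∨ 2 ≤ t by omega) with rfl | ht2
      · exact ⟨[x], a, [x], b, [x], c', rfl, rfl, rfl, by simp, ha', by simp, hb',
          by simp, by simp⟩
      obtain ⟨a₁, a₂, b₁, b₂, c₁, c₂, h1, h2, h3, h4, h5, h6, h7, h8, h9⟩ :=
        iha b c' (t - 2) ha' hb' (by omega)
      exact ⟨x :: a₁, a₂, x :: b₁, b₂, x :: c₁, c₂, by simp [h1], by simp [h2], by simp [h3],
        h4.cons_cons _, h5, h6.cons_cons _, h7,
        by simp only [List.length_cons]; omega, by simp only [List.length_cons]; omega⟩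

theorem ED_le_of_common_sublist {α : Type*} [DecidableEq α] {a b c : List α} {ε : ℝ}
    (ha : c.Sublist a) (hb : c.Sublist b)
    (h : ε * ((a.length + b.length : ℕ) : ℝ) ≤ 2 * c.length) :
    (ED a b : ℝ) ≤ (1 - ε) * ((a.length + b.length : ℕ) : ℝ) := by
  have h1 : ED a b + 2 * c.length ≤ a.length + b.length := by
    have := length_le_lcsLen ha hb
    have := ha.length_le
    have := hb.length_le
    unfold ED
    omega
  have h2 : (ED a b : ℝ) + 2 * c.length ≤ ((a.length + b.length : ℕ) : ℝ) := by
    exact_mod_cast h1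
  linarith

theorem exists_common_sublist_of_ED_le {α : Type*} [DecidableEq α] {a b : List α} {ε : ℝ}
    (h : (ED a b : ℝ) ≤ (1 - ε) * ((a.length + b.length : ℕ) : ℝ)) :
    ∃ c : List α, c.Sublist a ∧ c.Sublist b ∧
      ε * ((a.length + b.length : ℕ) : ℝ) ≤ 2 * c.length := by
  obtain ⟨c, hca, hcb, hc⟩ := exists_sublist_length_eq_lcsLen a b
  refine ⟨c, hca, hcb, ?_⟩
  have h1 : a.length + b.length ≤ ED a b + 2 * c.length := by
    unfold ED
    omega
  have h2 : ((a.length + b.length : ℕ) : ℝ) ≤ ED a b + 2 * c.length := by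
    exact_mod_cast h1
  linarith

theorem length_substr {α : Type*} (S : List α) {i j : ℕ} (hi : 1 ≤ i)
    (hj : j ≤ S.length + 1) : (substr S i j).length = j - i := by
  simp only [substr, List.length_take, List.length_drop]
  omega

theorem substr_eq_of_eq_append {α : Type*} {S a₁ a₂ : List α} {i j : ℕ} (hi : 1 ≤ i)
    (hij : i ≤ j) (hj : j ≤ S.length + 1) (h : substr S i j = a₁ ++ a₂) :
    i + a₁.length + a₂.length = j ∧ substr S i (i + a₁.length) = a₁ ∧
      substr S (i + a₁.length) j = a₂ := by
  have hlen : a₁.length + a₂.length = j - i := by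
    rw [← List.length_append, ← h, length_substr S hi hj]
  refine ⟨by omega, ?_, ?_⟩
  · have := congrArg (List.take a₁.length) h
    rw [List.take_left, substr, List.take_take, min_eq_left (by omega)] at this
    rwa [substr, Nat.add_sub_cancel_left]
  · have := congrArg (List.drop a₁.length) h
    rw [List.drop_left, substr, List.drop_take, List.drop_drop] at this
    rw [substr, show i + a₁.length - 1 = i - 1 + a₁.length by omega,
      show j - (i + a₁.length) = j - i - a₁.length by omega]
    exact this

/-- A common subsequence of positive relative length forces both strings to be nonempty. -/
theorem length_pos_of_common_sublist {α : Type*} {a b c : List α} {ε : ℝ} (hε : 0 < ε)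
    (ha : c.Sublist a) (hb : c.Sublist b) (hl : 0 < a.length + b.length)
    (h : ε * ((a.length + b.length : ℕ) : ℝ) ≤ 2 * c.length) :
    0 < a.length ∧ 0 < b.length := by
  have h1 : (0 : ℝ) < ((a.length + b.length : ℕ) : ℝ) := by exact_mod_cast hl
  have h2 : (0 : ℝ) < c.length := by nlinarith [mul_pos hε h1]
  have h3 : 0 < c.length := by exact_mod_cast h2
  exact ⟨h3.trans_le ha.length_le, h3.trans_le hb.length_le⟩

/-- If two disjoint intervals of a string of total length `l` have relative edit
distance at most `1 - ε`, then there are sub-intervals of total length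
`l' ∈ {⌈l/2⌉ - 1, ⌈l/2⌉, ⌈l/2⌉ + 1}` with relative edit distance at most `1 - ε`. -/
theorem stmt_0 {α : Type*} [DecidableEq α] (ε : ℝ) (hε0 : 0 < ε) (hε1 : ε ≤ 1)
    (S : List α) (i₁ j₁ i₂ j₂ : ℕ)
    (hi₁ : 1 ≤ i₁) (h₁ : i₁ < j₁) (h₂ : j₁ ≤ i₂) (h₃ : i₂ < j₂)
    (h₄ : j₂ ≤ S.length + 1)
    (hED : (ED (substr S i₁ j₁) (substr S i₂ j₂) : ℝ) ≤
      (1 - ε) * (((j₁ - i₁) + (j₂ - i₂) : ℕ) : ℝ)) :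
    ∃ i₁' j₁' i₂' j₂' : ℕ,
      i₁ ≤ i₁' ∧ i₁' < j₁' ∧ j₁' ≤ j₁ ∧
      i₂ ≤ i₂' ∧ i₂' < j₂' ∧ j₂' ≤ j₂ ∧
      ((j₁' - i₁') + (j₂' - i₂') = ((j₁ - i₁) + (j₂ - i₂) + 1) / 2 - 1 ∨
       (j₁' - i₁') + (j₂' - i₂') = ((j₁ - i₁) + (j₂ - i₂) + 1) / 2 ∨
       (j₁' - i₁') + (j₂' - i₂') = ((j₁ - i₁) + (j₂ - i₂) + 1) / 2 + 1) ∧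
      (ED (substr S i₁' j₁') (substr S i₂' j₂') : ℝ) ≤
        (1 - ε) * (((j₁' - i₁') + (j₂' - i₂') : ℕ) : ℝ) := by
  by_cases hl : (j₁ - i₁) + (j₂ - i₂) ≤ 3
  · exact ⟨i₁, j₁, i₂, j₂, le_rfl, h₁, le_rfl, le_rfl, h₃, le_rfl, by omega, hED⟩
  have hlen₁ := length_substr S hi₁ (show j₁ ≤ S.length + 1 by omega)
  have hlen₂ := length_substr S (show 1 ≤ i₂ by omega) h₄
  rw [← hlen₁, ← hlen₂] at hED
  obtain ⟨c, hca, hcb, hc⟩ := exists_common_sublist_of_ED_le hED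
  obtain ⟨a₁, a₂, b₁, b₂, c₁, c₂, ha, hb, rfl, hca₁, hca₂, hcb₁, hcb₂, ht₁, ht₂⟩ :=
    exists_split_common_sublist _ _ c (((j₁ - i₁) + (j₂ - i₂)) / 2) hca hcb (by omega)
  obtain ⟨hj₁, hpre₁, hsuf₁⟩ := substr_eq_of_eq_append hi₁ h₁.le (by omega) ha
  obtain ⟨hj₂, hpre₂, hsuf₂⟩ := substr_eq_of_eq_append (by omega) h₃.le h₄ hb
  rw [ha, hb] at hc
  by_cases hfst : ε * ((a₁.length + b₁.length : ℕ) : ℝ) ≤ 2 * c₁.length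
  · have hpos := length_pos_of_common_sublist hε0 hca₁ hcb₁ (by omega) hfst
    refine ⟨i₁, i₁ + a₁.length, i₂, i₂ + b₁.length, le_rfl, by omega, by omega, le_rfl,
      by omega, by omega, by omega, ?_⟩
    rw [hpre₁, hpre₂, Nat.add_sub_cancel_left, Nat.add_sub_cancel_left]
    exact ED_le_of_common_sublist hca₁ hcb₁ hfst
  · have hsnd : ε * ((a₂.length + b₂.length : ℕ) : ℝ) ≤ 2 * c₂.length := by
      push_cast [List.length_append] at hc hfst ⊢
      linarith
    have hpos := length_pos_of_common_sublist hε0 hca₂ hcb₂ (by omega) hsnd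
    refine ⟨i₁ + a₁.length, j₁, i₂ + b₁.length, j₂, by omega, by omega, le_rfl, by omega,
      by omega, le_rfl, by omega, ?_⟩
    rw [hsuf₁, hsuf₂, show j₁ - (i₁ + a₁.length) = a₂.length by omega,
      show j₂ - (i₂ + b₁.length) = b₂.length by omega]
    exact ED_le_of_common_sublist hca₂ hcb₂ hsnd
end

section
/- Let 0 < ε < 1, let Σ be a finite alphabet, let N be a positive integer, and let 𝒞 ⊆ Σ^N be a nonempty set of codewords any two distinct elements of which have edit distance at least 2(1-ε)·N. Let S be the string of length n = |𝒞|·N obtained by concatenating all codewords of 𝒞, each exactly once, in an arbitrary fixed order. Then for all indices 1 ≤ i₁ < j₁ ≤ i₂ < j₂ ≤ n+1 with total length l := (j₁-i₁)+(j₂-i₂) ≥ 4N/ε, we have ED(S[i₁,j₁), S[i₂,j₂)) ≥ (1-4ε)·l. -/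
/-- If common subsequences of a block of `As` and a block of `Bs` have length at most `K`, then a
common subsequence of the two concatenations has length at most `K` times the number of blocks. -/
theorem length_le_of_sublist_flatten {α : Type*} {K : ℝ} (hK : 0 ≤ K) (As Bs : List (List α))
    (h : ∀ a ∈ As, ∀ b ∈ Bs, ∀ c : List α, c.Sublist a → c.Sublist b → (c.length : ℝ) ≤ K)
    (c : List α) (hA : c.Sublist As.flatten) (hB : c.Sublist Bs.flatten) :
    (c.length : ℝ) ≤ (As.length + Bs.length) * K := by
  match As, Bs with
  | [], Bs =>
    have : c = [] := by simpa using hA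
    subst this
    simp only [List.length_nil, Nat.cast_zero]
    positivity
  | a :: As, [] =>
    have : c = [] := by simpa using hB
    subst this
    simp only [List.length_nil, Nat.cast_zero]
    positivity
  | a :: As, b :: Bs =>
    obtain ⟨c₁, c₂, hc, hc₁, hc₂⟩ := List.sublist_append_iff.1 (List.flatten_cons ▸ hA)
    obtain ⟨d₁, d₂, hd, hd₁, hd₂⟩ := List.sublist_append_iff.1 (List.flatten_cons ▸ hB)
    rcases le_total c₁.length d₁.length with hl | hl
    · have hp : c₁ <+: d₁ :=
        List.prefix_of_prefix_length_le (hc ▸ List.prefix_append c₁ c₂)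
          (hd ▸ List.prefix_append d₁ d₂) hl
      have h₁ := h a (by simp) b (by simp) c₁ hc₁ (hp.sublist.trans hd₁)
      have h₂ := length_le_of_sublist_flatten hK As (b :: Bs)
        (fun x hx y hy => h x (List.mem_cons_of_mem _ hx) y hy) c₂ hc₂
        ((hc ▸ List.sublist_append_right c₁ c₂ : c₂.Sublist c).trans hB)
      rw [hc]
      push_cast [List.length_append, List.length_cons] at h₂ ⊢
      linarith
    · have hp : d₁ <+: c₁ :=
        List.prefix_of_prefix_length_le (hd ▸ List.prefix_append d₁ d₂)
          (hc ▸ List.prefix_append c₁ c₂) hl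
      have h₁ := h a (by simp) b (by simp) d₁ (hp.sublist.trans hc₁) hd₁
      have h₂ := length_le_of_sublist_flatten hK (a :: As) Bs
        (fun x hx y hy => h x hx y (List.mem_cons_of_mem _ hy)) d₂
        ((hd ▸ List.sublist_append_right d₁ d₂ : d₂.Sublist c).trans hA) hd₂
      rw [hd]
      push_cast [List.length_append, List.length_cons] at h₂ ⊢
      linarith
termination_by As.length + Bs.length

theorem take_flatten_of_length_eq {α : Type*} {N : ℕ} (m : ℕ) (cs : List (List α))
    (h : ∀ w ∈ cs, w.length = N) : cs.flatten.take (m * N) = (cs.take m).flatten := by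
  induction cs generalizing m with
  | nil => simp
  | cons w cs ih =>
    cases m with
    | zero => simp
    | succ m =>
      have hw : w.length = N := h w (by simp)
      have hm : (m + 1) * N - w.length = m * N := by rw [hw, Nat.succ_mul]; omega
      have hm' : w.length ≤ (m + 1) * N := by rw [hw, Nat.succ_mul]; omega
      rw [List.flatten_cons, List.take_append, hm, ih m fun v hv => h v (by simp [hv]),
        List.take_of_length_le hm']
      simp

theorem drop_flatten_of_length_eq {α : Type*} {N : ℕ} (m : ℕ) (cs : List (List α))
    (h : ∀ w ∈ cs, w.length = N) : cs.flatten.drop (m * N) = (cs.drop m).flatten := by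
  apply List.append_cancel_left (as := (cs.take m).flatten)
  rw [← List.flatten_append, List.take_append_drop, ← take_flatten_of_length_eq m cs h,
    List.take_append_drop]

theorem drop_take_flatten_of_length_eq {α : Type*} {N : ℕ} (x m : ℕ) (cs : List (List α))
    (h : ∀ w ∈ cs, w.length = N) :
    (cs.flatten.take (m * N)).drop (x * N) = ((cs.take m).drop x).flatten := by
  rw [take_flatten_of_length_eq m cs h,
    drop_flatten_of_length_eq x _ fun w hw => h w (List.mem_of_mem_take hw)]

theorem substr_eq_drop_take {α : Type*} (S : List α) {i j : ℕ} (hi : 1 ≤ i) (hij : i ≤ j) :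
    substr S i j = (S.take (j - 1)).drop (i - 1) := by
  rw [substr, List.drop_take]
  congr 1
  omega

theorem drop_take_sublist_drop_take {α : Type*} (S : List α) {a b a' b' : ℕ} (ha : a' ≤ a)
    (hb : b ≤ b') : ((S.take b).drop a).Sublist ((S.take b').drop a') :=
  ((List.take_prefix_take_left hb).sublist.drop a).trans
    (List.drop_suffix_drop_left _ ha).sublist

theorem lcsLen_le_of_le_ED {α : Type*} [DecidableEq α] {ε : ℝ} {N : ℕ} {w v : List α}
    (hw : w.length = N) (hv : v.length = N) (h : 2 * (1 - ε) * N ≤ (ED w v : ℝ)) :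
    (lcsLen w v : ℝ) ≤ ε * N := by
  obtain ⟨c, hcw, -, hc⟩ := exists_sublist_length_eq_lcsLen w v
  have hle := hcw.length_le
  have hED : ED w v + 2 * lcsLen w v = 2 * N := by
    unfold ED
    omega
  have hED' : (ED w v : ℝ) + 2 * lcsLen w v = 2 * N := by exact_mod_cast hED
  linarith

theorem lcsLen_substr_flatten_le {α : Type*} [DecidableEq α] {K : ℝ} (hK : 0 ≤ K) {N : ℕ}
    (hN : 0 < N) {cs : List (List α)} (hnodup : cs.Nodup) (hlen : ∀ w ∈ cs, w.length = N)
    (hlcs : ∀ w ∈ cs, ∀ v ∈ cs, w ≠ v → (lcsLen w v : ℝ) ≤ K) {i₁ j₁ i₂ j₂ : ℕ} (hi₁ : 1 ≤ i₁)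
    (h₁ : i₁ ≤ j₁) (h₁₂ : j₁ ≤ i₂) (h₂ : i₂ ≤ j₂) :
    ∃ k : ℕ, k * N ≤ (j₁ - i₁) + (j₂ - i₂) + 3 * N ∧
      (lcsLen (substr cs.flatten i₁ j₁) (substr cs.flatten i₂ j₂) : ℝ) ≤ k * K + N := by
  obtain ⟨c, hcA, hcB, hc⟩ := exists_sublist_length_eq_lcsLen
    (substr cs.flatten i₁ j₁) (substr cs.flatten i₂ j₂)
  rw [← hc]
  rw [substr_eq_drop_take _ hi₁ h₁] at hcA
  rw [substr_eq_drop_take _ (by omega) h₂] at hcB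
  set x := (i₁ - 1) / N
  set m := (j₁ - 1) / N
  set y := (i₂ - 1) / N
  set z := (j₂ - 1) / N + 1 with hz
  have hx₁ : x * N ≤ i₁ - 1 := Nat.div_mul_le_self _ _
  have hx₂ : i₁ - 1 < x * N + N := Nat.lt_div_mul_add hN
  have hm₁ : m * N ≤ j₁ - 1 := Nat.div_mul_le_self _ _
  have hm₂ : j₁ - 1 < m * N + N := Nat.lt_div_mul_add hN
  have hy₁ : y * N ≤ i₂ - 1 := Nat.div_mul_le_self _ _
  have hy₂ : i₂ - 1 < y * N + N := Nat.lt_div_mul_add hN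
  have hz₁ : z * N ≤ j₂ - 1 + N := by
    rw [hz, Nat.succ_mul]
    exact Nat.add_le_add_right (Nat.div_mul_le_self _ _) N
  have hz₂ : j₂ - 1 ≤ z * N := by
    rw [hz, Nat.succ_mul]
    exact (Nat.lt_div_mul_add hN).le
  have hmy : m ≤ y := Nat.div_le_div_right (by omega)
  refine ⟨(m - x) + (z - y), ?_, ?_⟩
  · rw [Nat.add_mul, Nat.sub_mul, Nat.sub_mul]
    omega
  have hB : c.Sublist ((cs.take z).drop y).flatten := by
    rw [← drop_take_flatten_of_length_eq y z cs hlen]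
    exact hcB.trans (drop_take_sublist_drop_take _ hy₁ hz₂)
  have hsplit : cs.flatten.take (j₁ - 1) =
      cs.flatten.take (m * N) ++ (cs.flatten.drop (m * N)).take (j₁ - 1 - m * N) := by
    rw [← List.take_add]
    congr 1
    omega
  rw [hsplit, List.drop_append] at hcA
  obtain ⟨c₁, c₂, rfl, hc₁, hc₂⟩ := List.sublist_append_iff.1 hcA
  have hA : c₁.Sublist ((cs.take m).drop x).flatten := by
    rw [← drop_take_flatten_of_length_eq x m cs hlen]
    exact hc₁.trans (drop_take_sublist_drop_take _ hx₁ le_rfl)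
  have hlen₂ : c₂.length ≤ N := by
    have := hc₂.length_le
    simp only [List.length_drop, List.length_take] at this
    omega
  have hpair : ∀ w ∈ (cs.take m).drop x, ∀ v ∈ (cs.take z).drop y, ∀ d : List α,
      d.Sublist w → d.Sublist v → (d.length : ℝ) ≤ K := by
    intro w hw v hv d hdw hdv
    have hw' := List.mem_of_mem_drop hw
    have hv' : v ∈ cs.drop y := by
      rw [List.drop_take] at hv
      exact List.mem_of_mem_take hv
    have hne : w ≠ v := by
      rintro rfl
      exact List.disjoint_take_drop hnodup hmy hw' hv'
    have := hlcs w (List.mem_of_mem_take hw') v (List.mem_of_mem_drop hv') hne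
    exact le_trans (by exact_mod_cast length_le_lcsLen hdw hdv) this
  have hmain := length_le_of_sublist_flatten hK _ _ hpair c₁ hA
    ((List.sublist_append_left c₁ c₂).trans hB)
  have hcount : (((cs.take m).drop x).length + ((cs.take z).drop y).length : ℝ) ≤
      ((m - x + (z - y) : ℕ) : ℝ) := by
    have : ((cs.take m).drop x).length + ((cs.take z).drop y).length ≤ m - x + (z - y) := by
      simp only [List.length_drop, List.length_take]
      omega
    exact_mod_cast this
  have hmul := mul_le_mul_of_nonneg_right hcount hK
  have hlen₂' : (c₂.length : ℝ) ≤ N := by exact_mod_cast hlen₂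
  rw [List.length_append, Nat.cast_add]
  linarith

/-- Concatenating all codewords of a nonempty insertion-deletion code of block
length `N` and (absolute) distance at least `2(1-ε)·N` — each codeword exactly
once, in an arbitrary fixed order — gives a string `S` such that any two
disjoint intervals of total length `l ≥ 4N/ε` have edit distance at least
`(1-4ε)·l`. -/
theorem stmt_5 {α : Type*} [DecidableEq α] (ε : ℝ) (hε0 : 0 < ε) (hε1 : ε < 1)
    (N : ℕ) (hN : 0 < N) (cs : List (List α)) (hne : cs ≠ [])
    (hnodup : cs.Nodup) (hlen : ∀ w ∈ cs, w.length = N)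
    (hdist : ∀ w ∈ cs, ∀ w' ∈ cs, w ≠ w' → (ED w w' : ℝ) ≥ 2 * (1 - ε) * N)
    (S : List α) (hS : S = cs.flatten) :
    ∀ i₁ j₁ i₂ j₂ : ℕ, 1 ≤ i₁ → i₁ < j₁ → j₁ ≤ i₂ → i₂ < j₂ → j₂ ≤ S.length + 1 →
      (((j₁ - i₁) + (j₂ - i₂) : ℕ) : ℝ) ≥ 4 * N / ε →
      (ED (substr S i₁ j₁) (substr S i₂ j₂) : ℝ) ≥
        (1 - 4 * ε) * (((j₁ - i₁) + (j₂ - i₂) : ℕ) : ℝ) := by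
  intro i₁ j₁ i₂ j₂ hi₁ h₁ h₁₂ h₂ hj₂ hl
  subst hS
  set l : ℕ := (j₁ - i₁) + (j₂ - i₂) with hldef
  obtain ⟨k, hk, hlcs⟩ := lcsLen_substr_flatten_le (K := ε * N) (by positivity) hN hnodup hlen
    (fun w hw v hv hwv => lcsLen_le_of_le_ED (hlen w hw) (hlen v hv) (hdist w hw v hv hwv))
    hi₁ h₁.le h₁₂ h₂.le
  have hED : l ≤ ED (substr cs.flatten i₁ j₁) (substr cs.flatten i₂ j₂) +
      2 * lcsLen (substr cs.flatten i₁ j₁) (substr cs.flatten i₂ j₂) := by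
    have hlen₁ : (substr cs.flatten i₁ j₁).length = j₁ - i₁ := by
      simp only [substr, List.length_take, List.length_drop]
      omega
    have hlen₂ : (substr cs.flatten i₂ j₂).length = j₂ - i₂ := by
      simp only [substr, List.length_take, List.length_drop]
      omega
    unfold ED
    omega
  have hED' : (l : ℝ) ≤ ED (substr cs.flatten i₁ j₁) (substr cs.flatten i₂ j₂) +
      2 * lcsLen (substr cs.flatten i₁ j₁) (substr cs.flatten i₂ j₂) := by exact_mod_cast hED
  have hk' : (k : ℝ) * N ≤ l + 3 * N := by exact_mod_cast hk
  have hl' : 4 * (N : ℝ) ≤ l * ε := (div_le_iff₀ hε0).1 hl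
  have hkε := mul_le_mul_of_nonneg_left hk' hε0.le
  have hNε : ε * (N : ℝ) ≤ N := mul_le_of_le_one_left (Nat.cast_nonneg N) hε1.le
  linarith
end

section
/- For every real γ > 0 there exist constants K > 0 and ε₀ > 0 such that for every ε ∈ (0, ε₀) there are infinitely many block lengths n for which there exists a code C ⊆ Σⁿ over an alphabet Σ of size at most K·ε^{-(1+γ)} with |C| ≥ |Σ|^{ε^{2.01}·n/K}, such that any two distinct codewords of C differ in at least (1-ε)·n coordinates (i.e., the code has relative Hamming distance at least 1-ε and rate at least ε^{2.01}/K). -/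
open Finset in
/-- The words over an alphabet of size `q` that agree with `x` on `S`. -/
lemma card_filter_eqOn {n q : ℕ} (x : Fin n → Fin q) (S : Finset (Fin n)) :
    #{y : Fin n → Fin q | ∀ t ∈ S, x t = y t} = q ^ (n - #S) := by
  have h : ({y : Fin n → Fin q | ∀ t ∈ S, x t = y t} : Finset _) =
      Fintype.piFinset fun t => if t ∈ S then {x t} else univ := by
    ext y
    simp only [mem_filter, mem_univ, true_and, Fintype.mem_piFinset]
    refine forall_congr' fun t => ?_
    by_cases ht : t ∈ S <;> simp [ht, eq_comm]
  rw [h, Fintype.card_piFinset]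
  have h' : ∀ t, #(if t ∈ S then {x t} else (univ : Finset (Fin q))) =
      if t ∈ S then 1 else q := fun t => by split_ifs <;> simp
  simp only [h', prod_ite, prod_const, one_pow, one_mul]
  congr 1
  rw [filter_not, filter_mem_eq_inter, univ_inter, card_sdiff_of_subset (subset_univ _)]
  simp

open Finset in
/-- The number of words agreeing with `x` in at least `m` coordinates. -/
lemma card_filter_le_agree {n q m : ℕ} (x : Fin n → Fin q) :
    #{y : Fin n → Fin q | m ≤ #{t | x t = y t}} ≤ n.choose m * q ^ (n - m) := by
  have hsub : ({y : Fin n → Fin q | m ≤ #{t | x t = y t}} : Finset _) ⊆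
      (powersetCard m univ).biUnion fun S => {y | ∀ t ∈ S, x t = y t} := by
    intro y hy
    obtain ⟨S, hS, hSm⟩ := exists_subset_card_eq (mem_filter.1 hy).2
    refine mem_biUnion.2 ⟨S, mem_powersetCard.2 ⟨subset_univ _, hSm⟩, ?_⟩
    exact mem_filter.2 ⟨mem_univ _, fun t ht => (mem_filter.1 (hS ht)).2⟩
  calc _ ≤ _ := card_le_card hsub
    _ ≤ #(powersetCard m (univ : Finset (Fin n))) * q ^ (n - m) := by
        refine card_biUnion_le_card_mul _ _ _ fun S hS => ?_
        rw [card_filter_eqOn, (mem_powersetCard.1 hS).2]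
    _ = _ := by simp

open Finset in
/-- **Gilbert–Varshamov bound**: there is a large code whose distinct codewords agree in fewer
than `m` coordinates. -/
lemma exists_code_agree_lt {n q m : ℕ} (hq : 0 < q) (hm : m ≤ n) :
    ∃ C : Finset (Fin n → Fin q), q ^ m ≤ #C * n.choose m ∧
      ∀ x ∈ C, ∀ y ∈ C, x ≠ y → #{t | x t = y t} < m := by
  classical
  let P : Finset (Fin n → Fin q) → Prop := fun C =>
    ∀ x ∈ C, ∀ y ∈ C, x ≠ y → #{t | x t = y t} < m
  obtain ⟨C, hC, hmax⟩ := exists_max_image (univ.filter P) card ⟨∅, by simp [P]⟩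
  replace hC : P C := (mem_filter.1 hC).2
  refine ⟨C, ?_, hC⟩
  have hcover : (univ : Finset (Fin n → Fin q)) ⊆
      C.biUnion fun x => {y | m ≤ #{t | x t = y t}} := by
    intro y _
    by_contra hy
    simp only [mem_biUnion, mem_filter, mem_univ, true_and, not_exists, not_and, not_le] at hy
    have hyC : y ∉ C := fun h => by simpa using (hy y h).trans_le hm
    have hP : P (insert y C) := by
      intro a ha b hb hab
      rcases mem_insert.1 ha with rfl | haC <;> rcases mem_insert.1 hb with rfl | hbC
      · exact absurd rfl hab
      · simpa only [eq_comm] using hy b hbC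
      · exact hy a haC
      · exact hC a haC b hbC hab
    have := hmax _ (mem_filter.2 ⟨mem_univ _, hP⟩)
    rw [card_insert_of_notMem hyC] at this
    omega
  have hle : q ^ n ≤ #C * (n.choose m * q ^ (n - m)) := by
    calc q ^ n = #(univ : Finset (Fin n → Fin q)) := by simp
      _ ≤ _ := card_le_card hcover
      _ ≤ _ := card_biUnion_le_card_mul _ _ _ fun x _ => card_filter_le_agree x
  refine Nat.le_of_mul_le_mul_right ?_ (pow_pos hq (n - m))
  rw [← pow_add, Nat.add_sub_cancel' hm, mul_assoc]
  exact hle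

lemma choose_le_exp_mul_div_pow {n m : ℕ} (hm : 0 < m) :
    (n.choose m : ℝ) ≤ (Real.exp 1 * n / m) ^ m := by
  have hm' : (0 : ℝ) < m := by exact_mod_cast hm
  have hf : (0 : ℝ) < m.factorial := by exact_mod_cast m.factorial_pos
  have h := Real.pow_div_factorial_le_exp (m : ℝ) hm'.le m
  calc (n.choose m : ℝ) ≤ (n : ℝ) ^ m / m.factorial := Nat.choose_le_pow_div m n
    _ = (n / m : ℝ) ^ m * ((m : ℝ) ^ m / m.factorial) := by
        rw [div_pow]; field_simp
    _ ≤ (n / m : ℝ) ^ m * Real.exp m := by gcongr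
    _ = _ := by rw [← Real.exp_one_pow, ← mul_pow]; ring

/-- Codes over an alphabet of size `q` with relative distance `1 - ε` and large size. -/
lemma exists_code_of_le_mul {n q : ℕ} {ε : ℝ} (hε : 0 < ε) (hε1 : ε < 1) (hn : 0 < n)
    (hq : Real.exp 1 ≤ q * ε) :
    ∃ C : Finset (Fin n → Fin q), (q * ε / Real.exp 1) ^ (ε * n) ≤ (C.card : ℝ) ∧
      ∀ x ∈ C, ∀ y ∈ C, x ≠ y →
        (1 - ε) * n ≤ ((Finset.univ.filter fun t : Fin n => x t ≠ y t).card : ℝ) := by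
  have hn' : (0 : ℝ) < n := by exact_mod_cast hn
  have he := Real.exp_pos 1
  have hq0 : (0 : ℝ) < q := pos_of_mul_pos_left (he.trans_le hq) hε.le
  set m := ⌊ε * n⌋₊ + 1 with hm
  have hmn : m ≤ n := (Nat.floor_lt (by positivity)).2 (by nlinarith)
  have hεm : ε * n ≤ m := by simpa [hm] using (Nat.lt_floor_add_one (ε * n)).le
  have hm0 : (0 : ℝ) < m := by positivity
  obtain ⟨C, hC, hd⟩ := exists_code_agree_lt (q := q) (by exact_mod_cast hq0) hmn
  refine ⟨C, ?_, fun x hx y hy hxy => ?_⟩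
  · have hC' : (q : ℝ) ^ m ≤ C.card * (Real.exp 1 * n / m) ^ m := by
      calc (q : ℝ) ^ m ≤ C.card * n.choose m := by exact_mod_cast hC
        _ ≤ _ := by gcongr; exact choose_le_exp_mul_div_pow (by omega)
    calc (q * ε / Real.exp 1) ^ (ε * n) ≤ (q * ε / Real.exp 1) ^ (m : ℝ) :=
          Real.rpow_le_rpow_of_exponent_le ((one_le_div he).2 hq) hεm
      _ = (q * ε / Real.exp 1) ^ m := Real.rpow_natCast _ _
      _ ≤ (q / (Real.exp 1 * n / m)) ^ m := by
          gcongr ?_ ^ m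
          rw [div_div_eq_mul_div, div_le_div_iff₀ he (by positivity)]
          nlinarith [mul_le_mul_of_nonneg_left hεm (mul_pos hq0 he).le]
      _ ≤ C.card := by rw [div_pow]; exact div_le_of_le_mul₀ (by positivity) (by positivity) hC'
  · have h1 : (Finset.univ.filter fun t : Fin n => x t = y t).card ≤ ⌊ε * n⌋₊ :=
      Nat.le_of_lt_succ (hd x hx y hy hxy)
    have h2 := (Nat.cast_le (α := ℝ).2 h1).trans (Nat.floor_le (by positivity))
    have h3 := Finset.card_filter_add_card_filter_not (s := Finset.univ)
      (fun t : Fin n => x t = y t)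
    rw [Finset.card_univ, Fintype.card_fin] at h3
    have h4 : ((Finset.univ.filter fun t : Fin n => x t = y t).card : ℝ) +
      (Finset.univ.filter fun t : Fin n => x t ≠ y t).card = n := by exact_mod_cast h3
    linarith

/-- For every `γ > 0` there are constants `K > 0` and `ε₀ > 0` such that for
every `ε ∈ (0, ε₀)` there are infinitely many block lengths `n` admitting a code
`C ⊆ Σⁿ` over an alphabet `Σ` of size at most `K·ε^(-(1+γ))` with
`|C| ≥ |Σ|^(ε^2.01·n/K)` whose distinct codewords differ in at least `(1-ε)·n`
coordinates (relative Hamming distance at least `1-ε`, rate at least `ε^2.01/K`). -/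
theorem stmt_7 (γ : ℝ) (hγ : 0 < γ) :
    ∃ K ε₀ : ℝ, 0 < K ∧ 0 < ε₀ ∧ ∀ ε : ℝ, 0 < ε → ε < ε₀ →
      {n : ℕ | ∃ (m : ℕ) (C : Finset (Fin n → Fin m)),
        (m : ℝ) ≤ K * ε ^ (-(1 + γ)) ∧
        (C.card : ℝ) ≥ (m : ℝ) ^ (ε ^ (2.01 : ℝ) * n / K) ∧
        ∀ x ∈ C, ∀ y ∈ C, x ≠ y →
          ((Finset.univ.filter fun t : Fin n => x t ≠ y t).card : ℝ) ≥
            (1 - ε) * n}.Infinite := by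
  have he := Real.exp_pos 1
  have he3 : Real.exp 1 < 2.72 := Real.exp_one_lt_d9.trans (by norm_num)
  set K : ℝ := 20 + 2 * (1 + γ) with hK
  have hKpos : 0 < K := by positivity
  refine ⟨K, 1, hKpos, one_pos, fun ε hε hε1 => (Set.Ioi_infinite 0).mono fun n hn => ?_⟩
  set A : ℝ := ε ^ (-(1 + γ)) with hA
  have hA0 : 0 < A := by positivity
  have hAε : 1 ≤ A * ε := by
    calc (1 : ℝ) ≤ ε ^ (-γ) := Real.one_le_rpow_of_pos_of_le_one_of_nonpos hε hε1.le (by linarith)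
      _ = A * ε := by
        rw [hA]; nth_rewrite 3 [← Real.rpow_one ε]; rw [← Real.rpow_add hε]; ring_nf
  have hA1 : 1 ≤ A := hAε.trans (by nlinarith)
  set q := ⌊K * A⌋₊ with hq
  have hqle : (q : ℝ) ≤ K * A := Nat.floor_le (by positivity)
  have hqge : K * A - 1 < q := Nat.sub_one_lt_floor _
  have hqε : Real.exp 1 * Real.exp 1 ≤ q * ε := by nlinarith
  have hq0 : (0 : ℝ) < q := by nlinarith
  obtain ⟨C, hC, hd⟩ := exists_code_of_le_mul (q := q) hε hε1 hn
    (by nlinarith [Real.add_one_le_exp (1 : ℝ)])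
  refine ⟨q, C, hqle, le_trans ?_ hC, hd⟩
  have hn' : (0 : ℝ) < n := by exact_mod_cast hn
  have hlog : ε * Real.log q ≤ K := by
    have h1 : Real.log q ≤ Real.log K + (1 + γ) * Real.log ε⁻¹ := by
      calc Real.log q ≤ Real.log (K * A) := Real.log_le_log hq0 hqle
        _ = _ := by
          rw [Real.log_mul hKpos.ne' hA0.ne', hA, Real.log_rpow hε, Real.log_inv]; ring
    have h2 : Real.log ε⁻¹ ≤ ε⁻¹ := Real.log_le_self (by positivity)
    have h3 : Real.log K ≤ K / 2 := by
      have := Real.two_mul_le_exp (x := K / 2)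
      rw [Real.log_le_iff_le_exp hKpos]; linarith
    have h4 : ε * ε⁻¹ = 1 := mul_inv_cancel₀ hε.ne'
    calc ε * Real.log q ≤ ε * (K / 2 + (1 + γ) * ε⁻¹) := by
          gcongr; exact h1.trans (by gcongr)
      _ = ε * (K / 2) + (1 + γ) * (ε * ε⁻¹) := by ring
      _ ≤ K := by rw [h4]; nlinarith
  have hpow : ε ^ (2.01 : ℝ) ≤ ε * ε := by
    calc ε ^ (2.01 : ℝ) ≤ ε ^ (2 : ℝ) :=
          Real.rpow_le_rpow_of_exponent_ge hε hε1.le (by norm_num)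
      _ = ε * ε := by rw [Real.rpow_two, sq]
  have hlogq : 0 ≤ Real.log q := Real.log_natCast_nonneg q
  calc (q : ℝ) ^ (ε ^ (2.01 : ℝ) * n / K)
      = Real.exp (Real.log q * (ε ^ (2.01 : ℝ) * n / K)) := Real.rpow_def_of_pos hq0 _
    _ ≤ Real.exp (ε * n) := by
        refine Real.exp_le_exp.2 ?_
        calc Real.log q * (ε ^ (2.01 : ℝ) * n / K) ≤ Real.log q * (ε * ε * n / K) := by gcongr
          _ = (ε * Real.log q) * (ε * n / K) := by ring
          _ ≤ K * (ε * n / K) := by gcongr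
          _ = ε * n := by field_simp
    _ = Real.exp 1 ^ (ε * n) := by rw [← Real.exp_mul, one_mul]
    _ ≤ (q * ε / Real.exp 1) ^ (ε * n) := by
        gcongr
        exact (le_div_iff₀ he).2 hqε
end

section
/- There exist constants K > 0 and ε₀ > 0 such that for every ε ∈ (0, ε₀) there are infinitely many block lengths n for which there exists a set C ⊆ Σⁿ over an alphabet Σ of size at most ε^{-K} with |C| ≥ |Σ|^{ε^K·n}, such that any two distinct elements of C have edit distance greater than 2(1-ε)·n; consequently C is an insertion-deletion code of rate at least ε^K over an alphabet of size ε^{-O(1)} that can uniquely correct any (1-ε)·n insertions and deletions. -/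
theorem exists_common_sublist_of_le_lcsLen {α : Type*} [DecidableEq α] {a b : List α} {t : ℕ}
    (h : t ≤ lcsLen a b) : ∃ c : List α, c.length = t ∧ c.Sublist a ∧ c.Sublist b := by
  have foldr_max_mem : ∀ L : List ℕ, L.foldr max 0 = 0 ∨ L.foldr max 0 ∈ L := by
    intro L
    induction L with
    | nil => simp
    | cons x L ih =>
      rw [List.foldr_cons, List.mem_cons]
      rcases max_choice x (L.foldr max 0) with hx | hx <;> rw [hx] <;> tauto
  rcases foldr_max_mem ((a.sublists.filter fun c : List α => decide (c.Sublist b)).map List.length)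
    with h0 | hmem
  · have ht : t = 0 := Nat.le_zero.mp (h.trans h0.le)
    exact ⟨[], by simp [ht]⟩
  · obtain ⟨c, hc, hlen⟩ := List.mem_map.mp hmem
    rw [List.mem_filter, List.mem_sublists, decide_eq_true_eq] at hc
    have htc : t ≤ c.length := h.trans hlen.ge
    exact ⟨c.take t, by simp [htc], (List.take_sublist t c).trans hc.1,
      (List.take_sublist t c).trans hc.2⟩

/-- The words `f` and `g` have a common subsequence of length `t`. -/
def HasCommonSubseq {α : Type*} {n : ℕ} (t : ℕ) (f g : Fin n → α) : Prop :=
  ∃ φ ψ : Fin t ↪o Fin n, f ∘ φ = g ∘ ψ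

theorem exists_orderEmbedding_of_sublist_ofFn {α : Type*} {n : ℕ} {c : List α} {f : Fin n → α}
    (h : c.Sublist (List.ofFn f)) : ∃ φ : Fin c.length ↪o Fin n, c.get = f ∘ φ := by
  obtain ⟨φ, hφ⟩ := List.sublist_iff_exists_fin_orderEmbedding_get_eq.mp h
  refine ⟨φ.trans (Fin.castOrderIso (List.length_ofFn (f := f))).toOrderEmbedding, ?_⟩
  funext i
  rw [hφ i]
  simp
  rfl

theorem HasCommonSubseq.of_le_lcsLen {α : Type*} [DecidableEq α] {n t : ℕ} {f g : Fin n → α}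
    (h : t ≤ lcsLen (List.ofFn f) (List.ofFn g)) : HasCommonSubseq t f g := by
  obtain ⟨c, rfl, hf, hg⟩ := exists_common_sublist_of_le_lcsLen h
  obtain ⟨φ, hφ⟩ := exists_orderEmbedding_of_sublist_ofFn hf
  obtain ⟨ψ, hψ⟩ := exists_orderEmbedding_of_sublist_ofFn hg
  exact ⟨φ, ψ, hφ.symm.trans hψ⟩

theorem card_filter_comp_eq_le {α ι κ : Type*} [Fintype α] [DecidableEq α] [Fintype ι]
    [DecidableEq ι] [Fintype κ] (ψ : κ ↪ ι) (h : κ → α) :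
    (Finset.univ.filter fun g : ι → α => h = g ∘ ψ).card ≤
      Fintype.card α ^ (Fintype.card ι - Fintype.card κ) := by
  classical
  let T : Finset ι := Finset.univ.map ψ
  have hT : Fintype.card {i // i ∉ T} = Fintype.card ι - Fintype.card κ := by
    rw [Fintype.card_subtype_compl, Fintype.card_coe, Finset.card_map, Finset.card_univ]
  rw [← hT, ← Fintype.card_fun, ← Finset.card_univ]
  refine Finset.card_le_card_of_injOn (fun g i => g i.1)
    (fun _ _ => Finset.mem_coe.mpr (Finset.mem_univ _)) ?_
  intro g₁ h₁ g₂ h₂ heq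
  simp only [Finset.coe_filter, Finset.mem_univ, true_and, Set.mem_ofPred_eq] at h₁ h₂
  funext i
  by_cases hi : i ∈ T
  · obtain ⟨k, -, rfl⟩ := Finset.mem_map.mp hi
    exact congrFun (h₁.symm.trans h₂) k
  · exact congrFun heq ⟨i, hi⟩

theorem card_orderEmbedding_fin_le (t n : ℕ) : Fintype.card (Fin t ↪o Fin n) ≤ n.choose t := by
  classical
  calc Fintype.card (Fin t ↪o Fin n) = (Finset.univ : Finset (Fin t ↪o Fin n)).card := rfl
    _ ≤ (Finset.powersetCard t (Finset.univ : Finset (Fin n))).card := by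
        refine Finset.card_le_card_of_injOn (fun φ => Finset.univ.map φ.toEmbedding) ?_ ?_
        · intro φ _
          simp [Finset.mem_powersetCard]
        · intro φ _ ψ _ h
          rw [← OrderEmbedding.range_inj]
          simpa using congrArg (fun s : Finset (Fin n) => (s : Set (Fin n))) h
    _ = n.choose t := by simp

open Classical in
theorem card_hasCommonSubseq_le {m n : ℕ} (t : ℕ) (f : Fin n → Fin m) :
    (Finset.univ.filter fun g => HasCommonSubseq t f g).card ≤
      n.choose t ^ 2 * m ^ (n - t) := by
  have hsub : (Finset.univ.filter fun g => HasCommonSubseq t f g) ⊆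
      (Finset.univ : Finset ((Fin t ↪o Fin n) × (Fin t ↪o Fin n))).biUnion
        fun p => Finset.univ.filter fun g : Fin n → Fin m => f ∘ p.1 = g ∘ p.2 := by
    intro g hg
    obtain ⟨φ, ψ, h⟩ := (Finset.mem_filter.mp hg).2
    simp only [Finset.mem_biUnion, Finset.mem_filter, Finset.mem_univ, true_and]
    exact ⟨(φ, ψ), h⟩
  refine (Finset.card_le_card hsub).trans ((Finset.card_biUnion_le_card_mul _ _ (m ^ (n - t))
    fun p _ => ?_).trans ?_)
  · simpa using card_filter_comp_eq_le p.2.toEmbedding (f ∘ p.1)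
  · rw [Finset.card_univ, Fintype.card_prod, sq]
    gcongr <;> exact card_orderEmbedding_fin_le t n

open Classical in
/-- The Gilbert–Varshamov bound for an arbitrary reflexive symmetric relation. -/
theorem exists_pairwise_not_card_le_mul {α : Type*} [Fintype α] (r : α → α → Prop)
    (hrefl : ∀ x, r x x) (hsymm : ∀ x y, r x y → r y x) (B : ℕ)
    (hB : ∀ x, (Finset.univ.filter (r x)).card ≤ B) :
    ∃ C : Finset α, (∀ x ∈ C, ∀ y ∈ C, x ≠ y → ¬ r x y) ∧ Fintype.card α ≤ C.card * B := by
  obtain ⟨C, hC, hmax⟩ := Finset.exists_max_image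
    (Finset.univ.filter fun C : Finset α => ∀ x ∈ C, ∀ y ∈ C, x ≠ y → ¬ r x y)
    Finset.card ⟨∅, by simp⟩
  rw [Finset.mem_filter] at hC
  refine ⟨C, hC.2, ?_⟩
  rw [← Finset.card_univ]
  refine (Finset.card_le_card (t := C.biUnion fun x => Finset.univ.filter (r x)) ?_).trans
    (Finset.card_biUnion_le_card_mul _ _ _ fun x _ => hB x)
  intro y _
  simp only [Finset.mem_biUnion, Finset.mem_filter, Finset.mem_univ, true_and]
  by_contra! hy
  have hyC : y ∉ C := fun h => hy y h (hrefl y)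
  have hins := hmax (insert y C) (by
    rw [Finset.mem_filter]
    refine ⟨Finset.mem_univ _, fun a ha b hb hab => ?_⟩
    rcases Finset.mem_insert.mp ha with rfl | haC <;> rcases Finset.mem_insert.mp hb with rfl | hbC
    · exact absurd rfl hab
    · exact fun h => hy b hbC (hsymm _ _ h)
    · exact hy a haC
    · exact hC.2 a haC b hbC hab)
  rw [Finset.card_insert_of_notMem hyC] at hins
  omega

theorem exists_code_lcsLen_lt {m n t : ℕ} (ht : t ≤ n) :
    ∃ C : Finset (List (Fin m)), (∀ w ∈ C, w.length = n) ∧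
      (∀ w ∈ C, ∀ w' ∈ C, w ≠ w' → lcsLen w w' < t) ∧
      m ^ n ≤ C.card * (n.choose t ^ 2 * m ^ (n - t)) := by
  obtain ⟨C, hC, hcard⟩ := exists_pairwise_not_card_le_mul
    (HasCommonSubseq t : (Fin n → Fin m) → (Fin n → Fin m) → Prop)
    (fun _ => ⟨Fin.castLEOrderEmb ht, Fin.castLEOrderEmb ht, rfl⟩)
    (fun _ _ ⟨φ, ψ, h⟩ => ⟨ψ, φ, h.symm⟩) _ (card_hasCommonSubseq_le t)
  refine ⟨C.map ⟨List.ofFn, List.ofFn_injective⟩, ?_, ?_, ?_⟩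
  · simp
  · simp only [Finset.mem_map, Function.Embedding.coeFn_mk]
    rintro _ ⟨f, hf, rfl⟩ _ ⟨g, hg, rfl⟩ hne
    by_contra! h
    exact hC f hf g hg (fun hfg => hne (congrArg List.ofFn hfg)) (.of_le_lcsLen h)
  · simpa using hcard

theorem choose_le_exp_div_pow {ε : ℝ} (hε : 0 < ε) {n t : ℕ} (h : ε * n ≤ t) :
    (n.choose t : ℝ) ≤ (Real.exp 1 / ε) ^ t := by
  calc (n.choose t : ℝ) ≤ (n : ℝ) ^ t / t.factorial := Nat.choose_le_pow_div t n
    _ ≤ (t / ε) ^ t / t.factorial := by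
        gcongr
        rwa [le_div_iff₀ hε, mul_comm]
    _ = (t : ℝ) ^ t / t.factorial / ε ^ t := by rw [div_pow, div_right_comm]
    _ ≤ Real.exp t / ε ^ t := by
        gcongr
        exact Real.pow_div_factorial_le_exp (t : ℝ) (Nat.cast_nonneg t) t
    _ = (Real.exp 1 / ε) ^ t := by rw [div_pow, ← Real.exp_nat_mul, mul_one]

theorem exists_code_card_ge {ε : ℝ} (hε : 0 < ε) (hε1 : ε ≤ 1) {m : ℕ}
    (hm : (Real.exp 1 / ε) ^ 4 ≤ m) (n : ℕ) :
    ∃ C : Finset (List (Fin m)), (∀ w ∈ C, w.length = n) ∧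
      (∀ w ∈ C, ∀ w' ∈ C, w ≠ w' → (lcsLen w w' : ℝ) < ε * n) ∧
      (m : ℝ) ^ (ε * n / 2) ≤ C.card := by
  have htn : ⌈ε * n⌉₊ ≤ n := Nat.ceil_le.mpr (mul_le_of_le_one_left (Nat.cast_nonneg n) hε1)
  obtain ⟨C, hlen, hlcs, hcard⟩ := exists_code_lcsLen_lt (m := m) htn
  refine ⟨C, hlen, fun w hw w' hw' hne => Nat.lt_ceil.mp (hlcs w hw w' hw' hne), ?_⟩
  set t := ⌈ε * n⌉₊
  have ht : ε * n ≤ t := Nat.le_ceil _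
  have hbase : 1 ≤ Real.exp 1 / ε :=
    (one_le_div hε).mpr (hε1.trans (Real.one_le_exp zero_le_one))
  have hm1 : (1 : ℝ) ≤ m := (one_le_pow₀ hbase).trans hm
  have hm0 : (0 : ℝ) < m := one_pos.trans_le hm1
  have hchoose : (n.choose t : ℝ) ^ 2 ≤ (m : ℝ) ^ ((t : ℝ) / 2) := by
    calc (n.choose t : ℝ) ^ 2 ≤ ((Real.exp 1 / ε) ^ t) ^ 2 := by
          gcongr
          exact choose_le_exp_div_pow hε ht
      _ = ((Real.exp 1 / ε) ^ 4) ^ ((t : ℝ) / 2) := by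
          rw [← Real.rpow_natCast, ← Real.rpow_natCast, ← Real.rpow_natCast,
            ← Real.rpow_mul (by positivity), ← Real.rpow_mul (by positivity)]
          congr 1
          push_cast
          ring
      _ ≤ (m : ℝ) ^ ((t : ℝ) / 2) := Real.rpow_le_rpow (by positivity) hm (by positivity)
  have hmt : (m : ℝ) ^ t ≤ C.card * (m : ℝ) ^ ((t : ℝ) / 2) := by
    have hcast : (m : ℝ) ^ n ≤ C.card * ((n.choose t : ℝ) ^ 2 * (m : ℝ) ^ (n - t)) := by
      exact_mod_cast hcard
    have hsplit : (m : ℝ) ^ n = (m : ℝ) ^ t * (m : ℝ) ^ (n - t) := by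
      rw [← pow_add, Nat.add_sub_cancel' htn]
    rw [hsplit, ← mul_assoc] at hcast
    exact (le_of_mul_le_mul_right hcast (by positivity)).trans (by gcongr)
  have hhalf : (m : ℝ) ^ t = (m : ℝ) ^ ((t : ℝ) / 2) * (m : ℝ) ^ ((t : ℝ) / 2) := by
    rw [← Real.rpow_add hm0, add_halves, Real.rpow_natCast]
  rw [hhalf] at hmt
  exact (Real.rpow_le_rpow_of_exponent_le hm1 (by gcongr)).trans
    (le_of_mul_le_mul_right hmt (by positivity))

/-- There are constants `K > 0` and `ε₀ > 0` such that for every `ε ∈ (0, ε₀)`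
there are infinitely many block lengths `n` admitting a set `C ⊆ Σⁿ` over an
alphabet `Σ` of size at most `ε^(-K)` with `|C| ≥ |Σ|^(ε^K·n)` whose distinct
elements have pairwise edit distance greater than `2(1-ε)·n`; i.e., an
insertion-deletion code of rate at least `ε^K` over an alphabet of size
`ε^(-O(1))` uniquely correcting any `(1-ε)·n` insertions and deletions. -/
theorem stmt_8 :
    ∃ K ε₀ : ℝ, 0 < K ∧ 0 < ε₀ ∧ ∀ ε : ℝ, 0 < ε → ε < ε₀ →
      {n : ℕ | ∃ (m : ℕ) (C : Finset (List (Fin m))),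
        (m : ℝ) ≤ ε ^ (-K) ∧
        (C.card : ℝ) ≥ (m : ℝ) ^ (ε ^ K * n) ∧
        (∀ w ∈ C, w.length = n) ∧
        ∀ w ∈ C, ∀ w' ∈ C, w ≠ w' →
          (ED w w' : ℝ) > 2 * (1 - ε) * n}.Infinite := by
  refine ⟨9, 1 / 3, by norm_num, by norm_num, fun ε hε hε3 => ?_⟩
  refine Set.infinite_univ.mono fun n _ => ?_
  have hinv : 3 ≤ ε⁻¹ := by
    rw [le_inv_comm₀ (by norm_num) hε]
    linarith
  have hexp : Real.exp 1 ≤ ε⁻¹ := Real.exp_one_lt_three.le.trans hinv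
  have hm : (Real.exp 1 / ε) ^ 4 ≤ (⌈ε⁻¹ ^ 8⌉₊ : ℝ) := by
    calc (Real.exp 1 / ε) ^ 4 ≤ (ε⁻¹ / ε) ^ 4 := by gcongr
      _ = ε⁻¹ ^ 8 := by rw [div_eq_mul_inv]; ring
      _ ≤ _ := Nat.le_ceil _
  obtain ⟨C, hlen, hlcs, hcard⟩ := exists_code_card_ge hε (by linarith) hm n
  refine ⟨⌈ε⁻¹ ^ 8⌉₊, C, ?_, ?_, hlen, fun w hw w' hw' hne => ?_⟩
  · have h1 : (1 : ℝ) ≤ ε⁻¹ ^ 8 := one_le_pow₀ (by linarith)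
    calc (⌈ε⁻¹ ^ 8⌉₊ : ℝ) ≤ ε⁻¹ ^ 8 + 1 := (Nat.ceil_lt_add_one (by positivity)).le
      _ ≤ ε⁻¹ ^ 8 * ε⁻¹ := by nlinarith
      _ = ε ^ (-9 : ℝ) := by
          rw [Real.rpow_neg hε.le, ← Real.inv_rpow hε.le, ← pow_succ]
          exact (Real.rpow_natCast _ 9).symm
  · refine le_trans (Real.rpow_le_rpow_of_exponent_le ?_ ?_) hcard
    · exact (one_le_pow₀ (by linarith)).trans (Nat.le_ceil _)
    · have h9 : ε ^ (9 : ℝ) ≤ ε / 2 := by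
        calc ε ^ (9 : ℝ) ≤ ε ^ (2 : ℝ) :=
              Real.rpow_le_rpow_of_exponent_ge hε (by linarith) (by norm_num)
          _ = ε ^ 2 := Real.rpow_two ε
          _ ≤ ε / 2 := by nlinarith
      calc ε ^ (9 : ℝ) * n ≤ ε / 2 * n := by gcongr
        _ = ε * n / 2 := by ring
  · have hED : 2 * (n : ℝ) ≤ ED w w' + 2 * lcsLen w w' := by
      have h : 2 * n ≤ ED w w' + 2 * lcsLen w w' := by
        rw [ED, hlen w hw, hlen w' hw']
        omega
      exact_mod_cast h
    linarith [hlcs w hw w' hw' hne]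
end

section
/- There exists a constant K > 0 such that for every ε with 0 < ε < 1 there exist a finite alphabet Σ with |Σ| ≤ K·ε^{-K} and an infinite string S : {1,2,3,…} → Σ such that for all positions 1 ≤ i < j < k it holds that ED(S[i,j), S[j,k)) > (1-ε)·(k-i); that is, an infinite ε-synchronization string over an alphabet of size polynomial in 1/ε exists. -/
/-- `substrInf S i j` is `S[i,j)` for an infinite (1-based) string `S`. -/
def substrInf {α : Type*} (S : ℕ → α) (i j : ℕ) : List α :=
  (List.range (j - i)).map fun t => S (i + t)

namespace SyncString

variable {α : Type*}

/-- `v` is nonempty and contains a scattered square `c ++ c` with `|v| ≤ N * |c|`. -/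
def HasDenseSquare (N : ℕ) (v : List α) : Prop :=
  v ≠ [] ∧ ∃ c : List α, (c ++ c).Sublist v ∧ v.length ≤ N * c.length

/-- No infix of `w` has a dense scattered square. -/
def AvoidsDenseSquares (N : ℕ) (w : List α) : Prop :=
  ∀ v : List α, v <:+: w → ¬ HasDenseSquare N v

lemma avoidsDenseSquares_cons {N : ℕ} {a : α} {w : List α} :
    AvoidsDenseSquares N (a :: w) ↔
      (∀ v, v <+: a :: w → ¬ HasDenseSquare N v) ∧ AvoidsDenseSquares N w := by
  simp only [AvoidsDenseSquares, List.infix_cons_iff]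
  grind

lemma AvoidsDenseSquares.of_infix {N : ℕ} {v w : List α} (hw : AvoidsDenseSquares N w)
    (h : v <:+: w) : AvoidsDenseSquares N v :=
  fun u hu => hw u (hu.trans h)

lemma HasDenseSquare.exists_length_eq {N t : ℕ} {v : List α} (hv : HasDenseSquare N v)
    (hmin : ∀ s, v.length ≤ N * s → t ≤ s) :
    ∃ c : List α, c.length = t ∧ (c ++ c).Sublist v := by
  obtain ⟨-, c, hc, hl⟩ := hv
  refine ⟨c.take t, by simpa using hmin _ hl, ?_⟩
  exact ((List.take_sublist t c).append (List.take_sublist t c)).trans hc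

section Counting

variable (α) [Fintype α]

/-- The finite set of words of length `n`. -/
noncomputable def words (n : ℕ) : Finset (List α) := (List.finite_length_eq α n).toFinset

variable {α}

@[simp] lemma mem_words {n : ℕ} {w : List α} : w ∈ words α n ↔ w.length = n := by
  simp [words]

open Classical in
lemma words_succ (n : ℕ) :
    words α (n + 1) = (Finset.univ ×ˢ words α n).image (fun p : α × List α => p.1 :: p.2) := by
  ext w
  cases w <;> simp

lemma card_words (n : ℕ) : (words α n).card = Fintype.card α ^ n := by
  classical
  induction n with
  | zero =>
    have : words α 0 = {[]} := by ext w; simp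
    simp [this]
  | succ n ih =>
    rw [words_succ, Finset.card_image_of_injective, Finset.card_product, ih, pow_succ']
    · simp
    · rintro ⟨a, v⟩ ⟨b, w⟩ h
      simpa using h

open Classical in
/-- A fixed word `d` is a subsequence of at most `((1 + x) m) ^ l / (x m) ^ |d|` words of length
`l` over an alphabet of size `m`. -/
lemma card_superwords_le {x : ℝ} (hx : 0 < x) (l : ℕ) (d : List α) :
    (((words α l).filter (fun v => d.Sublist v)).card : ℝ) * (x * Fintype.card α) ^ d.length ≤
      ((1 + x) * Fintype.card α) ^ l := by
  induction l generalizing d with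
  | zero =>
    have h0 : words α 0 = {[]} := by ext w; simp
    cases d <;> simp [h0, Finset.filter_singleton]
  | succ l ih =>
    cases d with
    | nil =>
      simp only [List.nil_sublist, Finset.filter_true, card_words, List.length_nil, pow_zero,
        mul_one, Nat.cast_pow]
      gcongr
      nlinarith [(Fintype.card α).cast_nonneg (α := ℝ)]
    | cons b d =>
      set m : ℝ := (Fintype.card α : ℝ) with hm
      have hm0 : 0 ≤ m := by positivity
      have hsub : (words α (l + 1)).filter (fun v => (b :: d).Sublist v) ⊆
          (Finset.univ ×ˢ (words α l).filter (fun v => (b :: d).Sublist v)).image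
            (fun p : α × List α => p.1 :: p.2) ∪
          ((words α l).filter (fun v => d.Sublist v)).image (fun v => b :: v) := by
        intro v hv
        rw [words_succ] at hv
        simp only [Finset.mem_filter, Finset.mem_image, Finset.mem_product, Finset.mem_univ,
          true_and, Prod.exists] at hv
        obtain ⟨⟨a, w, hw, rfl⟩, hs⟩ := hv
        simp only [Finset.mem_union, Finset.mem_image, Finset.mem_product, Finset.mem_univ,
          true_and, Finset.mem_filter, Prod.exists]
        rcases List.sublist_cons_iff.1 hs with h | ⟨r, hr, h⟩
        · exact Or.inl ⟨a, w, ⟨hw, h⟩, rfl⟩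
        · obtain ⟨rfl, rfl⟩ := List.cons.inj hr
          exact Or.inr ⟨w, ⟨hw, h⟩, rfl⟩
      have hcard := (Finset.card_le_card hsub).trans ((Finset.card_union_le _ _).trans
        (add_le_add Finset.card_image_le Finset.card_image_le))
      rw [Finset.card_product, Finset.card_univ] at hcard
      have hcard' : (((words α (l + 1)).filter (fun v => (b :: d).Sublist v)).card : ℝ) ≤
          m * ((words α l).filter (fun v => (b :: d).Sublist v)).card +
            ((words α l).filter (fun v => d.Sublist v)).card := by
        rw [hm]
        exact_mod_cast hcard
      have h1 := mul_le_mul_of_nonneg_left (ih (b :: d)) hm0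
      have h2 := mul_le_mul_of_nonneg_right (ih d) (mul_nonneg hx.le hm0)
      refine (mul_le_mul_of_nonneg_right hcard' (by positivity)).trans ?_
      simp only [List.length_cons, pow_succ] at h1 h2 ⊢
      linarith

open Classical in
/-- The words of length `l` with a dense square. -/
noncomputable def denseSquareWords (α : Type*) [Fintype α] (N l : ℕ) : Finset (List α) :=
  (words α l).filter (HasDenseSquare N)

open Classical in
/-- The words of length `n` avoiding dense squares. -/
noncomputable def avoidingWords (α : Type*) [Fintype α] (N n : ℕ) : Finset (List α) :=
  (words α n).filter (AvoidsDenseSquares N)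

lemma one_add_inv_pow_le {N l t : ℕ} (hN : 0 < N) (h : l ≤ N * t) :
    (1 + (N : ℝ)⁻¹) ^ l ≤ 3 ^ t := by
  have hN' : (0 : ℝ) < N := by exact_mod_cast hN
  calc (1 + (N : ℝ)⁻¹) ^ l ≤ (1 + (N : ℝ)⁻¹) ^ (N * t) :=
        pow_le_pow_right₀ (by simp) h
    _ = ((1 + (N : ℝ)⁻¹) ^ N) ^ t := pow_mul _ _ _
    _ ≤ 3 ^ t := by
        gcongr
        calc (1 + (N : ℝ)⁻¹) ^ N ≤ (Real.exp (N : ℝ)⁻¹) ^ N := by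
              gcongr
              linarith [Real.add_one_le_exp (N : ℝ)⁻¹]
          _ = Real.exp 1 := by
              rw [← Real.exp_nat_mul, mul_inv_cancel₀ hN'.ne']
          _ ≤ 3 := by linarith [Real.exp_one_lt_d9]

/-- The words of length `l` with a dense square, counted in terms of the minimal `t` with
`l ≤ N * t`. -/
lemma card_denseSquareWords_mul_le {N l t : ℕ} (hN : 0 < N) (ht : l ≤ N * t)
    (hmin : ∀ s, l ≤ N * s → t ≤ s) :
    ((denseSquareWords α N l).card : ℝ) * ((N : ℝ)⁻¹ * Fintype.card α) ^ (2 * t) ≤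
      (Fintype.card α : ℝ) ^ t * ((1 + (N : ℝ)⁻¹) * Fintype.card α) ^ l := by
  classical
  have hsub : denseSquareWords α N l ⊆
      (words α t).biUnion (fun c => (words α l).filter (fun v => (c ++ c).Sublist v)) := by
    intro v hv
    simp only [denseSquareWords, Finset.mem_filter, mem_words] at hv
    obtain ⟨rfl, hv⟩ := hv
    obtain ⟨c, hc, hs⟩ := hv.exists_length_eq hmin
    simp only [Finset.mem_biUnion, Finset.mem_filter, mem_words]
    exact ⟨c, hc, trivial, hs⟩
  have hcard := (Finset.card_le_card hsub).trans Finset.card_biUnion_le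
  have hcard' : ((denseSquareWords α N l).card : ℝ) ≤
      ∑ c ∈ words α t, (((words α l).filter (fun v => (c ++ c).Sublist v)).card : ℝ) := by
    exact_mod_cast hcard
  refine (mul_le_mul_of_nonneg_right hcard' (by positivity)).trans ?_
  rw [Finset.sum_mul]
  refine (Finset.sum_le_card_nsmul _ _ (((1 + (N : ℝ)⁻¹) * Fintype.card α) ^ l) ?_).trans
    (by rw [card_words]; simp)
  intro c hc
  have hN' : (0 : ℝ) < (N : ℝ)⁻¹ := by positivity
  have := card_superwords_le hN' l (c ++ c)
  rw [mem_words] at hc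
  rwa [List.length_append, hc, ← two_mul] at this

/-- Over an alphabet of size `27 N² (N + 1)²`, the words with a dense square are rare, even after
rescaling by a growth rate slightly smaller than the size of the alphabet. -/
lemma card_denseSquareWords_le {N l : ℕ} (hN : 0 < N) (hl : 0 < l)
    (hcard : Fintype.card α = 27 * N ^ 2 * (N + 1) ^ 2) :
    ((denseSquareWords α N l).card : ℝ) ≤
      ((Fintype.card α : ℝ) / (1 + (N : ℝ)⁻¹)) ^ l *
        ((1 + (N : ℝ)⁻¹)⁻¹ ^ l / ((N : ℝ) + 1) ^ 2) := by
  have hN' : (0 : ℝ) < N := by exact_mod_cast hN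
  have hex : ∃ t, l ≤ N * t := ⟨l, Nat.le_mul_of_pos_left l hN⟩
  classical
  set t := Nat.find hex with htdef
  have ht : l ≤ N * t := Nat.find_spec hex
  have hmin : ∀ s, l ≤ N * s → t ≤ s := fun s hs => Nat.find_min' hex hs
  have ht0 : t ≠ 0 := by rintro h; simp [h] at ht; omega
  have hB := card_denseSquareWords_mul_le (α := α) hN ht hmin
  have hr := one_add_inv_pow_le hN ht
  set m : ℝ := (Fintype.card α : ℝ) with hm
  have hmval : m = 27 * (N : ℝ) ^ 2 * ((N : ℝ) + 1) ^ 2 := by rw [hm, hcard]; push_cast; ring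
  have hm0 : 0 < m := by rw [hmval]; positivity
  set r : ℝ := 1 + (N : ℝ)⁻¹ with hrdef
  have hr0 : 0 < r := by positivity
  have hr3 : r ^ l * r ^ l * r ^ l ≤ 27 ^ t := by
    calc r ^ l * r ^ l * r ^ l ≤ 3 ^ t * 3 ^ t * 3 ^ t := by gcongr
      _ = 27 ^ t := by rw [← mul_pow, ← mul_pow]; norm_num
  have hpow : (27 : ℝ) ^ t * ((N : ℝ) + 1) ^ 2 ≤ ((N : ℝ)⁻¹ ^ 2 * m) ^ t := by
    have h1 : (N : ℝ)⁻¹ ^ 2 * m = 27 * ((N : ℝ) + 1) ^ 2 := by rw [hmval]; field_simp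
    rw [h1, mul_pow]
    gcongr
    exact le_self_pow₀ (one_le_pow₀ (by linarith)) ht0
  have hB2 : ((denseSquareWords α N l).card : ℝ) * ((N : ℝ)⁻¹ ^ 2 * m) ^ t ≤ r ^ l * m ^ l := by
    have e1 : ((N : ℝ)⁻¹ * m) ^ (2 * t) = m ^ t * ((N : ℝ)⁻¹ ^ 2 * m) ^ t := by
      rw [pow_mul, ← mul_pow]; congr 1; ring
    rw [e1, mul_pow r m] at hB
    refine le_of_mul_le_mul_left ?_ (pow_pos hm0 t)
    linarith
  have key : ((denseSquareWords α N l).card : ℝ) * (r ^ l * r ^ l * r ^ l * ((N : ℝ) + 1) ^ 2) ≤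
      r ^ l * m ^ l := by
    refine le_trans ?_ hB2
    refine mul_le_mul_of_nonneg_left ?_ (by positivity)
    exact le_trans (by gcongr) hpow
  rw [div_pow, inv_pow]
  have hrl : 0 < r ^ l := by positivity
  have e2 : m ^ l / r ^ l * ((r ^ l)⁻¹ / ((N : ℝ) + 1) ^ 2) =
      r ^ l * m ^ l / (r ^ l * r ^ l * r ^ l * ((N : ℝ) + 1) ^ 2) := by
    field_simp
  rw [e2, le_div_iff₀ (by positivity)]
  exact key

/-- Extending avoiding words by one letter: the failures are covered by a dense square prefix
followed by a shorter avoiding word. -/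
lemma card_mul_card_avoidingWords_le (N n : ℕ) :
    Fintype.card α * (avoidingWords α N n).card ≤ (avoidingWords α N (n + 1)).card +
      ∑ l ∈ Finset.range (n + 1),
        (denseSquareWords α N (l + 1)).card * (avoidingWords α N (n - l)).card := by
  classical
  have hsub : (Finset.univ ×ˢ avoidingWords α N n).image (fun p : α × List α => p.1 :: p.2) ⊆
      avoidingWords α N (n + 1) ∪ (Finset.range (n + 1)).biUnion (fun l =>
        (denseSquareWords α N (l + 1) ×ˢ avoidingWords α N (n - l)).image
          (fun p => p.1 ++ p.2)) := by
    intro u hu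
    simp only [Finset.mem_image, Finset.mem_product, Finset.mem_univ, true_and, Prod.exists,
      avoidingWords, Finset.mem_filter, mem_words] at hu
    obtain ⟨a, w, ⟨rfl, hw⟩, rfl⟩ := hu
    by_cases h : AvoidsDenseSquares N (a :: w)
    · exact Finset.mem_union_left _ (by simp [avoidingWords, h])
    · refine Finset.mem_union_right _ ?_
      simp only [avoidsDenseSquares_cons, hw, and_true, not_forall, not_not] at h
      obtain ⟨v, ⟨s, hs⟩, hv⟩ := h
      obtain ⟨b, v, rfl⟩ := List.exists_cons_of_ne_nil hv.1
      obtain ⟨rfl, rfl⟩ := List.cons.inj hs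
      simp only [Finset.mem_biUnion, Finset.mem_range, Finset.mem_image, Finset.mem_product,
        Prod.exists, denseSquareWords, avoidingWords, Finset.mem_filter, mem_words]
      refine ⟨v.length, by simp, b :: v, s, ⟨⟨by simp, hv⟩, by simp, ?_⟩, by simp⟩
      exact hw.of_infix (List.suffix_append v s).isInfix
  have hcard := Finset.card_le_card hsub
  rw [Finset.card_image_of_injective, Finset.card_product, Finset.card_univ] at hcard
  · refine hcard.trans ((Finset.card_union_le _ _).trans ?_)
    gcongr
    refine Finset.card_biUnion_le.trans (Finset.sum_le_sum fun l _ => ?_)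
    exact Finset.card_image_le.trans (Finset.card_product _ _).le
  · rintro ⟨a, v⟩ ⟨b, w⟩ h
    simpa using h

lemma card_avoidingWords_succ {N : ℕ} (hN : 0 < N)
    (hcard : Fintype.card α = 27 * N ^ 2 * (N + 1) ^ 2) (n : ℕ) :
    (Fintype.card α : ℝ) / (1 + (N : ℝ)⁻¹) * (avoidingWords α N n).card ≤
      (avoidingWords α N (n + 1)).card := by
  have hN' : (0 : ℝ) < N := by exact_mod_cast hN
  have hB := fun l => card_denseSquareWords_le (α := α) (l := l + 1) hN l.succ_pos hcard
  have hext := fun n => card_mul_card_avoidingWords_le (α := α) N n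
  set r : ℝ := 1 + (N : ℝ)⁻¹ with hr
  have hr0 : 0 < r := by positivity
  set m : ℝ := (Fintype.card α : ℝ) with hm
  set β : ℝ := m / r with hβ
  have hβ0 : 0 ≤ β := by positivity
  induction n using Nat.strong_induction_on with
  | _ n ih =>
    have hmono : ∀ l ≤ n, β ^ l * ((avoidingWords α N (n - l)).card : ℝ) ≤
        (avoidingWords α N n).card := by
      intro l
      induction l with
      | zero => simp
      | succ l ihl =>
        intro hl
        refine le_trans ?_ (ihl (by omega))
        have h := ih (n - (l + 1)) (by omega)
        rw [show n - (l + 1) + 1 = n - l by omega] at h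
        rw [pow_succ, mul_assoc]
        gcongr
    set g : ℝ := ((avoidingWords α N n).card : ℝ) with hg
    have hg0 : 0 ≤ g := by positivity
    have hgeom : ∑ l ∈ Finset.range (n + 1), r⁻¹ ^ (l + 1) ≤ (N : ℝ) := by
      have hr1 : r⁻¹ = N / (N + 1) := by rw [hr]; field_simp
      have hlt : r⁻¹ < 1 := by rw [hr1, div_lt_one (by positivity)]; linarith
      have hs := geom_sum_eq hlt.ne (n + 1)
      have hp : 0 ≤ r⁻¹ ^ (n + 1) := by positivity
      simp only [pow_succ _ _]
      rw [← Finset.sum_mul, hs]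
      have : (r⁻¹ ^ (n + 1) - 1) / (r⁻¹ - 1) * r⁻¹ = (1 - r⁻¹ ^ (n + 1)) * N := by
        generalize r⁻¹ ^ (n + 1) = y
        rw [hr1]
        have : (N : ℝ) / (N + 1) - 1 ≠ 0 := by
          rw [← hr1]; linarith
        rw [div_mul_eq_mul_div, div_eq_iff this]
        field_simp
        ring
      rw [this]
      nlinarith
    have hsum : ∑ l ∈ Finset.range (n + 1), ((denseSquareWords α N (l + 1)).card : ℝ) *
        (avoidingWords α N (n - l)).card ≤ m / (N + 1) * g := by
      calc _ ≤ ∑ l ∈ Finset.range (n + 1), r⁻¹ ^ (l + 1) * (β * g / ((N : ℝ) + 1) ^ 2) := by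
            refine Finset.sum_le_sum fun l hl => ?_
            have h1 := hmono l (by simpa [Nat.lt_succ_iff] using hl)
            calc _ ≤ β ^ (l + 1) * (r⁻¹ ^ (l + 1) / ((N : ℝ) + 1) ^ 2) *
                  ((avoidingWords α N (n - l)).card : ℝ) := by gcongr; exact hB l
              _ = β * (r⁻¹ ^ (l + 1) / ((N : ℝ) + 1) ^ 2) *
                  (β ^ l * ((avoidingWords α N (n - l)).card : ℝ)) := by ring
              _ ≤ β * (r⁻¹ ^ (l + 1) / ((N : ℝ) + 1) ^ 2) * g := by gcongr
              _ = _ := by ring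
        _ ≤ N * (β * g / ((N : ℝ) + 1) ^ 2) := by
            rw [← Finset.sum_mul]
            gcongr
        _ ≤ (N + 1) * (m * g / ((N : ℝ) + 1) ^ 2) := by
            gcongr
            · linarith
            · exact div_le_self (by positivity) (by rw [hr]; simp)
        _ = _ := by field_simp
    have h := hext n
    have h' : m * g ≤ (avoidingWords α N (n + 1)).card +
        ∑ l ∈ Finset.range (n + 1), ((denseSquareWords α N (l + 1)).card : ℝ) *
          (avoidingWords α N (n - l)).card := by
      rw [hm, hg]
      exact_mod_cast h
    have e : β * g = m * g - m / (N + 1) * g := by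
      rw [hβ, hr]; field_simp; ring
    linarith

lemma avoidingWords_nonempty {N : ℕ} (hN : 0 < N)
    (hcard : Fintype.card α = 27 * N ^ 2 * (N + 1) ^ 2) (n : ℕ) :
    (avoidingWords α N n).Nonempty := by
  induction n with
  | zero =>
    refine ⟨[], ?_⟩
    simp only [avoidingWords, Finset.mem_filter, mem_words, List.length_nil, true_and]
    intro v hv h
    exact h.1 (List.infix_nil.1 hv)
  | succ n ih =>
    rw [← Finset.card_pos] at ih ⊢
    have h := card_avoidingWords_succ (α := α) hN hcard n
    have hm : 0 < Fintype.card α := by rw [hcard]; positivity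
    have : (0 : ℝ) < (Fintype.card α : ℝ) / (1 + (N : ℝ)⁻¹) * (avoidingWords α N n).card := by
      positivity
    exact_mod_cast this.trans_le h

end Counting

/-- By compactness, some infinite string has all its reversed prefixes avoiding dense squares. -/
lemma exists_infinite_avoiding {N : ℕ} (hN : 0 < N) {m : ℕ}
    (hm : m = 27 * N ^ 2 * (N + 1) ^ 2) :
    ∃ S : ℕ → Fin m, ∀ n, AvoidsDenseSquares N ((List.range n).map S).reverse := by
  have hm0 : 0 < m := by rw [hm]; positivity
  let C : ℕ → Set (ℕ → Fin m) :=
    fun n => {S | AvoidsDenseSquares N ((List.range n).map S).reverse}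
  have hclosed : ∀ n, IsClosed (C n) := by
    intro n
    have : C n = (fun (S : ℕ → Fin m) (i : Fin n) => S i) ⁻¹'
        {w | AvoidsDenseSquares N (List.ofFn w).reverse} := by
      ext S
      simp only [C, Set.mem_ofPred_eq, Set.mem_preimage]
      rw [← List.map_coe_finRange_eq_range, List.map_map, List.ofFn_eq_map]
      rfl
    rw [this]
    exact (isClosed_discrete _).preimage (by fun_prop)
  obtain ⟨S, hS⟩ := IsCompact.nonempty_iInter_of_sequence_nonempty_isCompact_isClosed C
    (fun n S hS => by
      refine AvoidsDenseSquares.of_infix (hS : AvoidsDenseSquares N _) ?_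
      rw [List.range_succ]
      simp only [List.map_append, List.map_cons, List.map_nil, List.reverse_append,
        List.reverse_singleton, List.singleton_append]
      exact (List.suffix_cons _ _).isInfix)
    (fun n => by
      obtain ⟨w, hw⟩ := avoidingWords_nonempty (α := Fin m) hN (by simpa using hm) n
      simp only [avoidingWords, Finset.mem_filter, mem_words] at hw
      obtain ⟨rfl, hw⟩ := hw
      refine ⟨fun i => w.reverse.getD i ⟨0, hm0⟩, ?_⟩
      simp only [C, Set.mem_ofPred_eq]
      convert hw
      rw [List.reverse_eq_iff]
      refine List.ext_getElem (by simp) fun i h1 h2 => ?_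
      simp only [List.getElem_map, List.getElem_range]
      exact List.getD_eq_getElem _ _ h2)
    (hclosed 0).isCompact hclosed
  exact ⟨S, fun n => Set.mem_iInter.1 hS n⟩

lemma exists_common_sublist_length_eq_lcsLen [DecidableEq α] (a b : List α) :
    ∃ c : List α, c.Sublist a ∧ c.Sublist b ∧ c.length = lcsLen a b := by
  have hfold : ∀ L : List (List α), (∀ c ∈ L, c.Sublist a ∧ c.Sublist b) →
      ∃ c : List α, c.Sublist a ∧ c.Sublist b ∧
        c.length = (L.map List.length).foldr max 0 := by
    intro L
    induction L with
    | nil => exact fun _ => ⟨[], by simp⟩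
    | cons d L ih =>
      intro h
      obtain ⟨c, hca, hcb, hc⟩ := ih fun c hc => h c (List.mem_cons_of_mem d hc)
      obtain ⟨hda, hdb⟩ := h d List.mem_cons_self
      rcases le_total d.length c.length with hle | hle
      · exact ⟨c, hca, hcb, by simp [← hc, hle]⟩
      · exact ⟨d, hda, hdb, by simp [← hc, hle]⟩
  exact hfold _ fun c hc => by simpa using hc

lemma lcsLen_substrInf_lt [DecidableEq α] {N : ℕ} {S : ℕ → α}
    (hS : ∀ n, AvoidsDenseSquares N ((List.range n).map S).reverse) {i j k : ℕ}
    (hij : i < j) (hjk : j < k) :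
    N * lcsLen (substrInf S i j) (substrInf S j k) < k - i := by
  obtain ⟨c, hca, hcb, hc⟩ :=
    exists_common_sublist_length_eq_lcsLen (substrInf S i j) (substrInf S j k)
  by_contra! hle
  have hlen : (substrInf S i j ++ substrInf S j k).length = k - i := by
    simp [substrInf]; omega
  refine hS k (substrInf S i j ++ substrInf S j k).reverse ?_ ⟨?_, c.reverse, ?_, ?_⟩
  · rw [List.reverse_infix]
    refine List.IsSuffix.isInfix ⟨(List.range i).map S, ?_⟩
    refine List.ext_getElem (by simp [substrInf]; omega) fun p h1 h2 => ?_
    simp only [substrInf, List.getElem_append, List.getElem_map, List.getElem_range,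
      List.length_map, List.length_range]
    split_ifs <;> congr 1 <;> omega
  · rw [← List.length_pos_iff, List.length_reverse, hlen]
    omega
  · rw [← List.reverse_append, List.reverse_sublist]
    exact hca.append hcb
  · rw [List.length_reverse, List.length_reverse, hlen, hc]
    exact hle

end SyncString

/-- There is a constant `K > 0` such that for every `0 < ε < 1` there is an
infinite `ε`-synchronization string over an alphabet of size at most `K·ε^(-K)`:
for all positions `1 ≤ i < j < k`, `ED(S[i,j), S[j,k)) > (1-ε)·(k-i)`. -/
theorem stmt_9 :
    ∃ K : ℝ, 0 < K ∧ ∀ ε : ℝ, 0 < ε → ε < 1 →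
      ∃ (m : ℕ) (S : ℕ → Fin m),
        (m : ℝ) ≤ K * ε ^ (-K) ∧
        ∀ i j k : ℕ, 1 ≤ i → i < j → j < k →
          (ED (substrInf S i j) (substrInf S j k) : ℝ) >
            (1 - ε) * ((k - i : ℕ) : ℝ) := by
  refine ⟨27 * 9 * 16, by norm_num, fun ε h0 h1 => ?_⟩
  set N := ⌈2 / ε⌉₊ with hNdef
  have hN : 0 < N := Nat.ceil_pos.2 (by positivity)
  have hNle : (N : ℝ) ≤ 3 / ε := by
    have h := Nat.ceil_lt_add_one (a := 2 / ε) (by positivity)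
    have h' : 1 ≤ 1 / ε := (one_le_div h0).2 h1.le
    have e : 3 / ε = 2 / ε + 1 / ε := by ring
    rw [← hNdef] at h
    linarith
  have hNge : 2 ≤ ε * N := by
    have h := Nat.le_ceil (2 / ε)
    rw [div_le_iff₀ h0] at h
    linarith
  obtain ⟨S, hS⟩ := SyncString.exists_infinite_avoiding hN rfl
  refine ⟨_, S, ?_, fun i j k _ hij hjk => ?_⟩
  · have hN1 : (N : ℝ) + 1 ≤ 4 / ε := by
      have h' : 1 ≤ 1 / ε := (one_le_div h0).2 h1.le
      have e : 4 / ε = 3 / ε + 1 / ε := by ring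
      linarith
    push_cast
    calc 27 * (N : ℝ) ^ 2 * (N + 1) ^ 2 ≤ 27 * (3 / ε) ^ 2 * (4 / ε) ^ 2 := by gcongr
      _ = 27 * 9 * 16 * ε ^ (-(4 : ℝ)) := by
          rw [Real.rpow_neg h0.le, show (4 : ℝ) = ((4 : ℕ) : ℝ) by norm_num, Real.rpow_natCast]
          field_simp
          norm_num
      _ ≤ _ := by
          gcongr ?_ * ?_
          exact Real.rpow_le_rpow_of_exponent_ge h0 h1.le (by norm_num)
  · have hlt := SyncString.lcsLen_substrInf_lt hS hij hjk
    have hlen : (substrInf S i j).length + (substrInf S j k).length = k - i := by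
      simp [substrInf]; omega
    set L := lcsLen (substrInf S i j) (substrInf S j k) with hL
    have hED : ((k - i : ℕ) : ℝ) ≤ (ED (substrInf S i j) (substrInf S j k) : ℝ) + 2 * L := by
      have : k - i ≤ ED (substrInf S i j) (substrInf S j k) + 2 * L := by
        rw [ED, hlen]; omega
      exact_mod_cast this
    have hlt' : (N : ℝ) * L < ((k - i : ℕ) : ℝ) := by exact_mod_cast hlt
    have h2 : 2 * (L : ℝ) < ε * ((k - i : ℕ) : ℝ) :=
      calc 2 * (L : ℝ) ≤ ε * N * L := by gcongr
        _ = ε * (N * L) := by ring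
        _ < _ := by gcongr
    linarith
end

section
/- Let k ≥ 2 be an integer. Define turning points q_i for i ≥ 1 by q_i = k^i + k^{i-2} + k^{i-4} + ⋯ (the sum of k^j over all j with 1 ≤ j ≤ i and j ≡ i (mod 2)), and set q₀ = q₋₁ = 0. Consider the family of U-blocks, namely the intervals of integers (q_{i-2}, q_i] for odd i ≥ 1, and the family of V-blocks, namely the intervals (q_{i-2}, q_i] for even i ≥ 2; each family partitions the positive integers. Then for all positive integers x < z and every integer t ≥ 1 with k^t ≤ z - x < k^{t+1}, there exists a single block B among the U-blocks or the V-blocks such that the number of integers in [x, z) that do not belong to B is at most (3/k)·(z - x). -/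
/-- The turning point `q k i = k^i + k^(i-2) + k^(i-4) + ⋯`, i.e., the sum of
`k^j` over `1 ≤ j ≤ i` with `j ≡ i (mod 2)`. (With `ℕ`-subtraction, both
`q k 0` and `q k (1-2)` are `0`, matching `q₀ = q₋₁ = 0`.) -/
def q (k i : ℕ) : ℕ := ∑ j ∈ Finset.Icc 1 i, if j % 2 = i % 2 then k ^ j else 0

theorem q_zero (k : ℕ) : q k 0 = 0 := by simp [q]

theorem q_add_two (k n : ℕ) : q k (n + 2) = q k n + k ^ (n + 2) := by
  have h : (n + 1) % 2 ≠ n % 2 := by omega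
  have h' : (n + 1 + 1) % 2 = n % 2 := by omega
  simp [q, Finset.sum_Icc_succ_top, h, h']

theorem mul_q_le_q_succ (k n : ℕ) : k * q k n ≤ q k (n + 1) := by
  induction n using Nat.twoStepInduction with
  | zero => simp [q_zero]
  | one => rw [q_add_two k 0]; simp [q, pow_two]
  | more n ih _ =>
    rw [q_add_two k n, q_add_two k (n + 1), mul_add, ← pow_succ']
    exact Nat.add_le_add_right ih _

theorem pow_le_q (k : ℕ) {n : ℕ} (hn : 1 ≤ n) : k ^ n ≤ q k n := by
  obtain ⟨m, rfl⟩ := Nat.exists_eq_add_of_le' hn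
  simp [q, Finset.sum_Icc_succ_top]

/-- The interval `[x, z)` is covered up to a `3/k` fraction by the block ending at the first
turning point that is at least `z - 1`. -/
theorem exists_mul_card_uncovered_le {k x z : ℕ} (hk : 2 ≤ k) (hx : 0 < x) (hxz : x < z) :
    ∃ i : ℕ, 1 ≤ i ∧
      k * ((Finset.Ico x z).filter fun a => ¬(q k (i - 2) < a ∧ a ≤ q k i)).card ≤
        3 * (z - x) := by
  have hex : ∃ i, z ≤ q k i + 1 :=
    ⟨z, by have := pow_le_q k (n := z) (by omega)
           have := Nat.lt_pow_self (n := z) (show 1 < k by omega)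
           omega⟩
  classical
  obtain ⟨i, hi, hmin⟩ : ∃ i, z ≤ q k i + 1 ∧ ∀ m < i, ¬ z ≤ q k m + 1 :=
    ⟨Nat.find hex, Nat.find_spec hex, fun m hm => Nat.find_min hex hm⟩
  have hi1 : 1 ≤ i := by
    rcases Nat.eq_zero_or_pos i with rfl | h
    · rw [q_zero] at hi; omega
    · exact h
  refine ⟨i, hi1, ?_⟩
  have hsub : ((Finset.Ico x z).filter fun a => ¬(q k (i - 2) < a ∧ a ≤ q k i)) ⊆
      Finset.Icc x (q k (i - 2)) := by
    intro a ha
    simp only [Finset.mem_filter, Finset.mem_Ico, Finset.mem_Icc] at ha ⊢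
    omega
  have hcard := Finset.card_le_card hsub
  rw [Nat.card_Icc] at hcard
  rcases lt_or_ge (q k (i - 2)) x with h | h
  · rw [show Finset.card _ = 0 by omega]
    simp
  · have hi2 : 2 ≤ i := by
      by_contra hlt
      rw [show i - 2 = 0 by omega, q_zero] at h
      omega
    have hm := hmin (i - 1) (by omega)
    have hq := mul_q_le_q_succ k (i - 2)
    rw [show i - 2 + 1 = i - 1 by omega] at hq
    have hle := Nat.mul_le_mul_left k (hcard.trans (show _ ≤ q k (i - 2) by omega))
    have h2 := Nat.mul_le_mul_right (q k (i - 2)) hk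
    omega

/-- Covering lemma: for `k ≥ 2`, the U-blocks `(q_{i-2}, q_i]` (odd `i ≥ 1`) and
V-blocks `(q_{i-2}, q_i]` (even `i ≥ 2`) satisfy: for all positive `x < z` and
`t ≥ 1` with `k^t ≤ z - x < k^(t+1)`, some single block `(q_{i-2}, q_i]` covers
all but at most a `3/k` fraction of the integers in `[x, z)`. -/
theorem stmt_10 (k : ℕ) (hk : 2 ≤ k) (x z t : ℕ) (hx : 0 < x) (hxz : x < z)
    (ht : 1 ≤ t) (h1 : k ^ t ≤ z - x) (h2 : z - x < k ^ (t + 1)) :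
    ∃ i : ℕ, 1 ≤ i ∧
      (((Finset.Ico x z).filter fun a => ¬(q k (i - 2) < a ∧ a ≤ q k i)).card : ℝ) ≤
        3 / k * ((z - x : ℕ) : ℝ) := by
  obtain ⟨i, hi, h⟩ := exists_mul_card_uncovered_le hk hx hxz
  refine ⟨i, hi, ?_⟩
  have hk0 : (0 : ℝ) < k := by exact_mod_cast (show 0 < k by omega)
  rw [div_mul_eq_mul_div, le_div_iff₀' hk0]
  exact_mod_cast h
end

section
/- Let 0 < ε < 1, c > 0, and let S be a c-long-distance ε-synchronization string of length n over an alphabet Σ; let ⊥ be a symbol not in Σ. For a string P and integer k ≥ 1, let suf_k(P) denote the last k symbols of P if k ≤ |P|, and the string ⊥^{k-|P|}·P (P padded on the left with k-|P| copies of ⊥) otherwise. Then for any two positions 1 ≤ i < j ≤ n there exists an integer k with 1 ≤ k ≤ ⌈c·log₂ n⌉ such that ED(suf_k(S[1,i]), suf_k(S[1,j])) > 2k·(1-ε); that is, the (c·log₂ n)-limited relative suffix distance between any two distinct prefixes of S exceeds 1-ε. -/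
/-- `S` is a `c`-long-distance `ε`-synchronization string: for all
`1 ≤ i < j ≤ i' < j' ≤ |S| + 1` such that either `i' = j` (adjacent intervals) or the
total length exceeds `c·log₂ |S|`, the edit distance of `S[i,j)` and `S[i',j')`
exceeds `(1-ε)` times the total length. -/
def LongDistSync {α : Type*} [DecidableEq α] (c ε : ℝ) (S : List α) : Prop :=
  ∀ i j i' j' : ℕ, 1 ≤ i → i < j → j ≤ i' → i' < j' → j' ≤ S.length + 1 →
    (i' = j ∨ c * Real.logb 2 S.length < (((j - i) + (j' - i') : ℕ) : ℝ)) →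
    (ED (substr S i j) (substr S i' j') : ℝ) >
      (1 - ε) * (((j - i) + (j' - i') : ℕ) : ℝ)


/-- `suf k P` is the suffix of `P` of length `k`, padded on the left with the
symbol `⊥ = none` (not in the alphabet) if `k > |P|`. -/
def suf {α : Type*} (k : ℕ) (P : List α) : List (Option α) :=
  List.replicate (k - P.length) none ++ (P.map some).drop (P.length - k)


theorem lcsLen_le_iff {α : Type*} [DecidableEq α] {a b : List α} {m : ℕ} :
    lcsLen a b ≤ m ↔ ∀ l : List α, l.Sublist a → l.Sublist b → l.length ≤ m := by
  have foldr_max_le_iff (L : List ℕ) : L.foldr max 0 ≤ m ↔ ∀ x ∈ L, x ≤ m := by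
    induction L with
    | nil => simp
    | cons x L ih => simp [ih]
  rw [lcsLen, foldr_max_le_iff, List.forall_mem_map]
  simp

theorem lcsLen_replicate_none_append_map_some_le {α : Type*} [DecidableEq α] (r : ℕ)
    (a b : List α) :
    lcsLen (List.replicate r none ++ a.map some) (b.map some) ≤ lcsLen a b := by
  rw [lcsLen_le_iff]
  intro l hla hlb
  obtain ⟨l', hl'b, rfl⟩ := List.sublist_map_iff.mp hlb
  have hl'a : l'.Sublist a := by
    simpa [List.filterMap_append, List.filterMap_map, List.filterMap_replicate] using
      hla.filterMap id
  simpa using lcsLen_le_iff.mp le_rfl l' hl'a hl'b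

theorem ED_add_le_ED_replicate_none_append_map_some {α : Type*} [DecidableEq α] (r : ℕ)
    {a b : List α} (h : 0 < ED a b) :
    r + ED a b ≤ ED (List.replicate r none ++ a.map some) (b.map some) := by
  have := lcsLen_replicate_none_append_map_some_le r a b
  simp only [ED, List.length_append, List.length_replicate, List.length_map] at h ⊢
  omega

theorem suf_take {α : Type*} (S : List α) {i k : ℕ} (hi : i ≤ S.length) :
    suf k (S.take i) =
      List.replicate (k - i) none ++ (substr S (i - k + 1) (i + 1)).map some := by
  simp [suf, substr, hi, ← List.map_drop, List.drop_take]

/-- For a `c`-long-distance `ε`-synchronization string `S` of length `n`, any two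
distinct prefixes `S[1,i]` and `S[1,j]` have `(c·log₂ n)`-limited relative suffix
distance exceeding `1-ε`: some `k` with `1 ≤ k ≤ ⌈c·log₂ n⌉` satisfies
`ED(suf_k(S[1,i]), suf_k(S[1,j])) > 2k·(1-ε)`. -/
theorem stmt_11 {α : Type*} [DecidableEq α] (ε c : ℝ) (hε0 : 0 < ε) (hε1 : ε < 1)
    (hc : 0 < c) (S : List α) (n : ℕ) (hn : S.length = n)
    (hS : LongDistSync c ε S) :
    ∀ i j : ℕ, 1 ≤ i → i < j → j ≤ n →
      ∃ k : ℕ, 1 ≤ k ∧ k ≤ ⌈c * Real.logb 2 n⌉₊ ∧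
        (ED (suf k (S.take i)) (suf k (S.take j)) : ℝ) > 2 * k * (1 - ε) := by
  intro i j hi hij hj
  subst hn
  set x := c * Real.logb 2 S.length with hx
  have hx0 : 0 < x := mul_pos hc (Real.logb_pos one_lt_two (by exact_mod_cast (by omega)))
  have hm : 0 < ⌈x⌉₊ := Nat.ceil_pos.mpr hx0
  obtain ⟨k, hk⟩ : ∃ k, k = min (j - i) ⌈x⌉₊ := ⟨_, rfl⟩
  refine ⟨k, by omega, by omega, ?_⟩
  have hcase : j - k + 1 = i + 1 ∨
      x < (((i + 1 - (i - k + 1)) + (j + 1 - (j - k + 1)) : ℕ) : ℝ) := by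
    rcases le_total (j - i) ⌈x⌉₊ with h | h
    · left; omega
    · right
      refine (Nat.le_ceil x).trans_lt ?_
      exact_mod_cast (by omega)
  have hED := hS (i - k + 1) (i + 1) (j - k + 1) (j + 1) (by omega) (by omega) (by omega)
    (by omega) (by omega) hcase
  have hpos : 0 < ED (substr S (i - k + 1) (i + 1)) (substr S (j - k + 1) (j + 1)) := by
    have : (0 : ℝ) ≤ (1 - ε) * (((i + 1 - (i - k + 1)) + (j + 1 - (j - k + 1)) : ℕ) : ℝ) :=
      mul_nonneg (by linarith) (Nat.cast_nonneg _)
    exact_mod_cast this.trans_lt hED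
  have hpad := ED_add_le_ED_replicate_none_append_map_some (k - i) hpos
  rw [suf_take S (by omega), suf_take S hj, show k - j = 0 by omega, List.replicate_zero,
    List.nil_append]
  have hlen : (((i + 1 - (i - k + 1)) + (j + 1 - (j - k + 1)) : ℕ) : ℝ) =
      2 * k - ((k - i : ℕ) : ℝ) := by
    rw [eq_sub_iff_add_eq]
    exact_mod_cast (by omega)
  rw [hlen] at hED
  have hpadR := (Nat.cast_le (α := ℝ)).mpr hpad
  push_cast [-Nat.cast_sub] at hpadR
  have : (0 : ℝ) ≤ ε * ((k - i : ℕ) : ℝ) := by positivity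
  linarith
end

section
/- Let 0 < ε < 1 and let S be an ε-synchronization string of length n over a finite alphabet Σ, where n ≥ 1/ε. Then |Σ| ≥ 1/ε - 1. -/
/-- `S` is an `ε`-synchronization string: for all positions `1 ≤ i < j < k ≤ |S| + 1`,
`ED(S[i,j), S[j,k)) > (1-ε)·(k-i)`. -/
def SyncString {α : Type*} [DecidableEq α] (ε : ℝ) (S : List α) : Prop :=
  ∀ i j k : ℕ, 1 ≤ i → i < j → j < k → k ≤ S.length + 1 →
    (ED (substr S i j) (substr S j k) : ℝ) > (1 - ε) * ((k - i : ℕ) : ℝ)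


theorem getElem_mem_substr {α : Type*} (S : List α) {i j p : ℕ} (hp : p < S.length)
    (hi : 1 ≤ i) (hip : i ≤ p + 1) (hpj : p + 1 < j) : S[p] ∈ substr S i j := by
  rw [substr, List.mem_iff_getElem]
  refine ⟨p - (i - 1), ?_, ?_⟩
  · simp only [List.length_take, List.length_drop]
    omega
  · simp only [List.getElem_take, List.getElem_drop]
    congr 1
    omega

/-- Equal symbols of an `ε`-synchronization string are far apart. -/
theorem SyncString.two_lt_of_getElem_eq {α : Type*} [DecidableEq α] {ε : ℝ} {S : List α}
    (hS : SyncString ε S) {p q : ℕ} (hpq : p < q) (hq : q < S.length)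
    (h : S[p] = S[q]) : 2 < ε * ((q : ℝ) - p + 1) := by
  have hED := hS (p + 1) (q + 1) (q + 2) (by omega) (by omega) (by omega) (by omega)
  have hp : S[p] ∈ substr S (p + 1) (q + 1) :=
    getElem_mem_substr S (by omega) (by omega) (by omega) (by omega)
  have hq' : S[p] ∈ substr S (q + 1) (q + 2) :=
    h ▸ getElem_mem_substr S hq (by omega) (by omega) (by omega)
  have hlcs := length_le_lcsLen (List.singleton_sublist.2 hp) (List.singleton_sublist.2 hq')
  have hle : ED (substr S (p + 1) (q + 1)) (substr S (q + 1) (q + 2)) + p + 1 ≤ q := by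
    rw [ED, length_substr S (by omega) (by omega), length_substr S (by omega) (by omega)]
    rw [List.length_singleton] at hlcs
    omega
  have hle' : (ED (substr S (p + 1) (q + 1)) (substr S (q + 1) (q + 2)) : ℝ) + p + 1 ≤ q := by
    exact_mod_cast hle
  rw [Nat.cast_sub (by omega)] at hED
  push_cast at hED
  linarith

/-- Any `ε`-synchronization string of length `n ≥ 1/ε` over a finite alphabet `Σ`
requires `|Σ| ≥ 1/ε - 1`. -/
theorem stmt_15 {α : Type*} [DecidableEq α] [Fintype α] (ε : ℝ)
    (hε0 : 0 < ε) (hε1 : ε < 1) (S : List α) (n : ℕ) (hn : S.length = n)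
    (hbig : (n : ℝ) ≥ 1 / ε) (hsync : SyncString ε S) :
    (Fintype.card α : ℝ) ≥ 1 / ε - 1 := by
  have hw : (⌊1 / ε⌋₊ : ℝ) ≤ 1 / ε := Nat.floor_le (by positivity)
  have hwn : ⌊1 / ε⌋₊ ≤ S.length := by
    rw [hn]
    exact_mod_cast hw.trans hbig
  have hnodup : (S.take ⌊1 / ε⌋₊).Nodup := by
    rw [List.nodup_iff_pairwise_ne, List.pairwise_iff_getElem]
    intro p q hp hq hpq heq
    rw [List.length_take] at hq
    rw [List.getElem_take, List.getElem_take] at heq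
    have hfar := hsync.two_lt_of_getElem_eq hpq (by omega) heq
    have hqw : (q : ℝ) + 1 ≤ ⌊1 / ε⌋₊ := by
      have : q + 1 ≤ ⌊1 / ε⌋₊ := by omega
      exact_mod_cast this
    have hp0 : (0 : ℝ) ≤ p := p.cast_nonneg
    have hnear : ε * ((q : ℝ) - p + 1) ≤ ε * (1 / ε) := by
      gcongr
      linarith
    rw [mul_one_div_cancel hε0.ne'] at hnear
    linarith
  have hcard := hnodup.length_le_card
  rw [List.length_take, min_eq_left hwn] at hcard
  have hcard' : (⌊1 / ε⌋₊ : ℝ) ≤ Fintype.card α := by exact_mod_cast hcard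
  linarith [Nat.lt_floor_add_one (1 / ε)]
end

section
/- Let 0 < ε < 1 and let f : ℕ → ℕ be super-exponential, i.e., for every real C > 1 the ratio f(l)/C^l tends to infinity as l → ∞. Then for every finite alphabet Σ there exists a positive integer n₀ such that for every n ≥ n₀ there is no f(l)-distance ε-synchronization string of length n over Σ. -/
/-- `S` is an `f(l)`-distance `ε`-synchronization string: for all positions
`1 ≤ i < j ≤ i' < j' ≤ |S| + 1` with `i' - j ≤ f(l)` where `l = (j-i)+(j'-i')`,
`ED(S[i,j), S[i',j')) > (1-ε)·l`. -/
def FDistSync {α : Type*} [DecidableEq α] (f : ℕ → ℕ) (ε : ℝ) (S : List α) : Prop :=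
  ∀ i j i' j' : ℕ, 1 ≤ i → i < j → j ≤ i' → i' < j' → j' ≤ S.length + 1 →
    i' - j ≤ f ((j - i) + (j' - i')) →
    (ED (substr S i j) (substr S i' j') : ℝ) >
      (1 - ε) * (((j - i) + (j' - i') : ℕ) : ℝ)


theorem List.le_foldr_max_of_mem {l : List ℕ} {x : ℕ} (h : x ∈ l) : x ≤ l.foldr max 0 := by
  induction l with
  | nil => simp at h
  | cons y t ih =>
    rcases List.mem_cons.1 h with rfl | h
    · exact le_max_left _ _
    · exact (ih h).trans (le_max_right _ _)

theorem length_le_lcsLen_self {α : Type*} [DecidableEq α] (a : List α) :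
    a.length ≤ lcsLen a a :=
  List.le_foldr_max_of_mem (List.mem_map_of_mem (by simp))

theorem ED_self {α : Type*} [DecidableEq α] (a : List α) : ED a a = 0 := by
  have := length_le_lcsLen_self a
  unfold ED
  omega

theorem length_substr_block {α : Type*} {S : List α} {i k : ℕ} (h : i + k ≤ S.length) :
    (substr S (i + 1) (i + k + 1)).length = k := by
  simp only [substr, List.length_take, List.length_drop]
  omega

/-- By pigeonhole, two of the first `|α| ^ k + 1` consecutive blocks of length `k` coincide. -/
theorem exists_eq_substr_blocks {α : Type*} [Fintype α] {S : List α} {k : ℕ}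
    (h : (Fintype.card α ^ k + 1) * k ≤ S.length) :
    ∃ p q : ℕ, p < q ∧ q ≤ Fintype.card α ^ k ∧
      substr S (p * k + 1) (p * k + k + 1) = substr S (q * k + 1) (q * k + k + 1) := by
  have hlen (p : Fin (Fintype.card α ^ k + 1)) : (p : ℕ) * k + k ≤ S.length := by
    have := Nat.mul_le_mul_right k (Nat.succ_le_of_lt p.isLt)
    rw [Nat.succ_mul] at this
    exact this.trans h
  let block (p : Fin (Fintype.card α ^ k + 1)) : List.Vector α k :=
    ⟨substr S (p * k + 1) (p * k + k + 1), length_substr_block (hlen p)⟩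
  obtain ⟨p, q, hne, heq⟩ := Fintype.exists_ne_map_eq_of_card_lt block (by simp [card_vector])
  have heq : substr S (p * k + 1) (p * k + k + 1) = substr S (q * k + 1) (q * k + k + 1) :=
    congrArg Subtype.val heq
  rcases lt_or_gt_of_ne hne with hlt | hlt
  · exact ⟨p, q, hlt, Nat.le_of_lt_succ q.isLt, heq⟩
  · exact ⟨q, p, hlt, Nat.le_of_lt_succ p.isLt, heq.symm⟩

theorem exists_mul_pow_le_of_superexponential {f : ℕ → ℕ}
    (hf : ∀ C : ℝ, 1 < C →
      Filter.Tendsto (fun l : ℕ => (f l : ℝ) / C ^ l) Filter.atTop Filter.atTop) (c : ℕ) :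
    ∃ k : ℕ, 0 < k ∧ c ^ k * k ≤ f (k + k) := by
  obtain ⟨N, hN⟩ := Filter.eventually_atTop.1
    ((hf (c + 2) (by linarith [c.cast_nonneg (α := ℝ)])).eventually_ge_atTop 1)
  refine ⟨N + 1, N.succ_pos, ?_⟩
  set k := N + 1
  have h := hN (k + k) (by omega)
  rw [le_div_iff₀ (by positivity), one_mul] at h
  have h : (c + 2) ^ (k + k) ≤ f (k + k) := by exact_mod_cast h
  calc c ^ k * k ≤ (c + 2) ^ k * (c + 2) ^ k :=
        Nat.mul_le_mul (Nat.pow_le_pow_left (by omega) k) (Nat.lt_pow_self (by omega)).le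
    _ = (c + 2) ^ (k + k) := (pow_add _ _ _).symm
    _ ≤ f (k + k) := h

/-- If `f : ℕ → ℕ` is super-exponential (for every `C > 1`, `f(l)/C^l → ∞`), then
for every `0 < ε < 1` and every finite alphabet `Σ` there is `n₀` such that no
`f(l)`-distance `ε`-synchronization string of length `n ≥ n₀` over `Σ` exists. -/
theorem stmt_17 {α : Type*} [DecidableEq α] [Fintype α] (ε : ℝ)
    (hε0 : 0 < ε) (hε1 : ε < 1) (f : ℕ → ℕ)
    (hf : ∀ C : ℝ, 1 < C →
      Filter.Tendsto (fun l : ℕ => (f l : ℝ) / C ^ l) Filter.atTop Filter.atTop) :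
    ∃ n₀ : ℕ, 0 < n₀ ∧ ∀ n : ℕ, n₀ ≤ n →
      ¬∃ S : List α, S.length = n ∧ FDistSync f ε S := by
  obtain ⟨k, hk, hfk⟩ := exists_mul_pow_le_of_superexponential hf (Fintype.card α)
  refine ⟨(Fintype.card α ^ k + 1) * k, by positivity, ?_⟩
  rintro n hn ⟨S, rfl, hS⟩
  obtain ⟨p, q, hpq, hq, heq⟩ := exists_eq_substr_blocks hn
  have hpk : p * k + k ≤ q * k := by
    rw [← Nat.succ_mul]
    exact Nat.mul_le_mul_right k hpq
  have hqk : q * k ≤ Fintype.card α ^ k * k := Nat.mul_le_mul_right k hq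
  rw [Nat.succ_mul] at hn
  have hl : (p * k + k + 1 - (p * k + 1)) + (q * k + k + 1 - (q * k + 1)) = k + k := by omega
  have h := hS (p * k + 1) (p * k + k + 1) (q * k + 1) (q * k + k + 1)
    (by omega) (by omega) (by omega) (by omega) (by omega) (by rw [hl]; omega)
  rw [hl, heq, ED_self, Nat.cast_zero] at h
  have : 0 ≤ (1 - ε) * ((k + k : ℕ) : ℝ) := mul_nonneg (by linarith) (Nat.cast_nonneg _)
  linarith
end
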